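/- arXiv:1807.00472 — 16 statements merged into one kernel-verified Lean document; each statement's English description precedes it below -/
import Mathlib

section
/- Let ρ be a stationary distribution of the Markov chain T. Then for every player n and every action σ_n ∈ {1,…,M_n}, one has ∑_{σ'∈Σ} T̃_n(σ_n|σ') ρ(σ') = 0; that is, ρ is orthogonal to every strategy (Press–Dyson) vector of every player (extension of Akin's lemma to multi-player multi-action games with public monitoring). -/
theorem akin_marginal {N : ℕ} {M : Fin N → ℕ} (f : (m : Fin N) → Fin (M m) → ℝ)
    (hf : ∀ m, ∑ x, f m x = 1) (n : Fin N) (a : Fin (M n)) :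
    ∑ σ : ∀ m, Fin (M m), (if a = σ n then (1:ℝ) else 0) * ∏ m, f m (σ m) = f n a := by
  classical
  let g : (m : Fin N) → Fin (M m) → ℝ :=
    Function.update f n (fun x => (if a = x then (1:ℝ) else 0) * f n x)
  have hgn : g n = fun x => (if a = x then (1:ℝ) else 0) * f n x := Function.update_self ..
  have hgm : ∀ m, m ≠ n → g m = f m := fun m hm => Function.update_of_ne hm ..
  have h1 : ∀ σ : ∀ m, Fin (M m),
      (if a = σ n then (1:ℝ) else 0) * ∏ m, f m (σ m) = ∏ m, g m (σ m) := by
    intro σ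
    rw [← Finset.mul_prod_erase Finset.univ _ (Finset.mem_univ n),
      ← Finset.mul_prod_erase Finset.univ (fun m => g m (σ m)) (Finset.mem_univ n), ← mul_assoc]
    simp only [hgn]
    congr 1
    refine Finset.prod_congr rfl fun m hm => ?_
    rw [hgm m (Finset.ne_of_mem_erase hm)]
  rw [Finset.sum_congr rfl fun σ _ => h1 σ, ← Fintype.prod_sum,
    ← Finset.mul_prod_erase Finset.univ _ (Finset.mem_univ n), Finset.prod_eq_one, hgn]
  · simp
  · intro m hm
    rw [hgm m (Finset.ne_of_mem_erase hm), hf]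

/-- Extension of Akin's lemma to multi-player multi-action games with public
monitoring: a stationary distribution `ρ` of the induced Markov chain is
orthogonal to every Press–Dyson (strategy) vector of every player. -/
theorem akin_lemma
    (N : ℕ) (hN : 1 ≤ N) (M : Fin N → ℕ) (hM : ∀ n, 1 ≤ M n)
    (B : Type) [Fintype B]
    (W : B → (∀ m, Fin (M m)) → ℝ)
    (hW0 : ∀ τ σ', 0 ≤ W τ σ')
    (hW1 : ∀ σ', ∑ τ, W τ σ' = 1)
    (That : (n : Fin N) → Fin (M n) → Fin (M n) → B → ℝ)
    (hThat0 : ∀ n a a' τ, 0 ≤ That n a a' τ)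
    (hThat1 : ∀ n (a' : Fin (M n)) (τ : B), ∑ a, That n a a' τ = 1)
    (ρ : (∀ m, Fin (M m)) → ℝ)
    (hρ0 : ∀ σ, 0 ≤ ρ σ)
    (hρ1 : ∑ σ, ρ σ = 1)
    (hρstat : ∀ σ, ρ σ =
      ∑ σ', (∑ τ, W τ σ' * ∏ m, That m (σ m) (σ' m) τ) * ρ σ')
    (n : Fin N) (a : Fin (M n)) :
    ∑ σ' : ∀ m, Fin (M m),
      ((∑ τ, W τ σ' * That n a (σ' n) τ) - (if a = σ' n then 1 else 0)) * ρ σ'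
      = 0 := by
  have key : ∑ σ : ∀ m, Fin (M m), (if a = σ n then (1:ℝ) else 0) * ρ σ
      = ∑ σ', (∑ τ, W τ σ' * That n a (σ' n) τ) * ρ σ' := by
    calc _ = ∑ σ : ∀ m, Fin (M m), ∑ σ', (if a = σ n then (1:ℝ) else 0) *
            ((∑ τ, W τ σ' * ∏ m, That m (σ m) (σ' m) τ) * ρ σ') := by
          refine Finset.sum_congr rfl fun σ _ => ?_
          rw [← Finset.mul_sum, ← hρstat σ]
      _ = _ := by
          rw [Finset.sum_comm]
          refine Finset.sum_congr rfl fun σ' _ => ?_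
          simp only [← mul_assoc]
          rw [← Finset.sum_mul]
          congr 1
          simp only [Finset.mul_sum]
          rw [Finset.sum_comm]
          refine Finset.sum_congr rfl fun τ _ => ?_
          rw [← akin_marginal (fun m x => That m x (σ' m) τ) (fun m => hThat1 m _ τ) n a,
            Finset.mul_sum]
          exact Finset.sum_congr rfl fun σ _ => mul_left_comm _ _ _
  simp only [sub_mul, Finset.sum_sub_distrib]
  rw [key, sub_self]
end

section
/- Let ρ be a stationary distribution of the Markov chain T, and let α = (α_0,α_1,…,α_N) ∈ ℝ^{N+1} be such that 𝒮α ∈ span(𝒯_n) for some player n. Then the expected payoffs satisfy the linear relation α_0 + ∑_{m=1}^N α_m e_m = 0; that is, a player employing a ZD strategy unilaterally enforces a linear relation between the expected payoffs of the players. -/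
theorem zd_aux_marginal {N : ℕ} {M : Fin N → ℕ} (f : (m : Fin N) → Fin (M m) → ℝ)
    (hf : ∀ m, ∑ b, f m b = 1) (n : Fin N) (a : Fin (M n)) :
    ∑ σ : (∀ m, Fin (M m)), (if a = σ n then 1 else 0) * ∏ m, f m (σ m) = f n a := by
  classical
  let g : (m : Fin N) → Fin (M m) → ℝ :=
    Function.update f n (fun b => if a = b then f n b else 0)
  have hgn : g n = fun b => if a = b then f n b else 0 := Function.update_self ..
  have hgm : ∀ m, m ≠ n → g m = f m := fun m hm => Function.update_of_ne hm ..
  have h1 : ∀ σ : (∀ m, Fin (M m)),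
      (if a = σ n then 1 else 0) * ∏ m, f m (σ m) = ∏ m, g m (σ m) := by
    intro σ
    rw [← Finset.mul_prod_erase _ _ (Finset.mem_univ n),
      ← Finset.mul_prod_erase _ (fun m => g m (σ m)) (Finset.mem_univ n), hgn, ← mul_assoc]
    congr 1
    · simp
    · refine Finset.prod_congr rfl fun m hm => ?_
      rw [hgm m (Finset.ne_of_mem_erase hm)]
  rw [Finset.sum_congr rfl fun σ _ => h1 σ, ← Fintype.prod_sum,
    Finset.prod_eq_single n]
  · simp [hgn]
  · intro m _ hm
    rw [hgm m hm, hf]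
  · simp


/-- A player employing a ZD strategy unilaterally enforces a linear relation
between the expected payoffs of the players: if `𝒮α ∈ span 𝒯_n`, then
`α₀ + ∑ m α_m e_m = 0` for the expected payoffs `e_m` with respect to any
stationary distribution `ρ`. -/
theorem zd_enforces_linear_relation
    (N : ℕ) (hN : 1 ≤ N) (M : Fin N → ℕ) (hM : ∀ n, 1 ≤ M n)
    (B : Type) [Fintype B]
    (W : B → (∀ m, Fin (M m)) → ℝ)
    (hW0 : ∀ τ σ', 0 ≤ W τ σ')
    (hW1 : ∀ σ', ∑ τ, W τ σ' = 1)
    (That : (n : Fin N) → Fin (M n) → Fin (M n) → B → ℝ)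
    (hThat0 : ∀ n a a' τ, 0 ≤ That n a a' τ)
    (hThat1 : ∀ n (a' : Fin (M n)) (τ : B), ∑ a, That n a a' τ = 1)
    (s : Fin N → (∀ m, Fin (M m)) → ℝ)
    (ρ : (∀ m, Fin (M m)) → ℝ)
    (hρ0 : ∀ σ, 0 ≤ ρ σ)
    (hρ1 : ∑ σ, ρ σ = 1)
    (hρstat : ∀ σ, ρ σ =
      ∑ σ', (∑ τ, W τ σ' * ∏ m, That m (σ m) (σ' m) τ) * ρ σ')
    (n : Fin N)
    (α : Fin (N + 1) → ℝ)
    (hα : (fun σ' : ∀ m, Fin (M m) => α 0 + ∑ m, α m.succ * s m σ') ∈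
      Submodule.span ℝ (Set.range fun a : Fin (M n) =>
        fun σ' : ∀ m, Fin (M m) =>
          (∑ τ, W τ σ' * That n a (σ' n) τ) - (if a = σ' n then 1 else 0))) :
    α 0 + ∑ m, α m.succ * (∑ σ, s m σ * ρ σ) = 0 := by
  classical
  have key : ∀ v ∈ Submodule.span ℝ (Set.range fun a : Fin (M n) =>
        fun σ' : ∀ m, Fin (M m) =>
          (∑ τ, W τ σ' * That n a (σ' n) τ) - (if a = σ' n then 1 else 0)),
      ∑ σ, v σ * ρ σ = 0 := by
    intro v hv
    induction hv using Submodule.span_induction with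
    | mem x hx =>
      obtain ⟨a, rfl⟩ := hx
      have e : ∑ σ, (if a = σ n then (1 : ℝ) else 0) * ρ σ
          = ∑ σ', (∑ τ, W τ σ' * That n a (σ' n) τ) * ρ σ' := by
        calc ∑ σ, (if a = σ n then (1 : ℝ) else 0) * ρ σ
            = ∑ σ : (∀ m, Fin (M m)), ∑ σ', ∑ τ, W τ σ' * ((if a = σ n then (1 : ℝ) else 0) *
                ∏ m, That m (σ m) (σ' m) τ) * ρ σ' := by
              refine Finset.sum_congr rfl fun σ _ => ?_
              rw [hρstat σ, Finset.mul_sum]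
              refine Finset.sum_congr rfl fun σ' _ => ?_
              rw [Finset.sum_mul, Finset.mul_sum]
              refine Finset.sum_congr rfl fun τ _ => ?_
              ring
          _ = _ := by
              rw [Finset.sum_comm]
              refine Finset.sum_congr rfl fun σ' _ => ?_
              rw [Finset.sum_comm, Finset.sum_mul]
              refine Finset.sum_congr rfl fun τ _ => ?_
              rw [← Finset.sum_mul, ← Finset.mul_sum,
                zd_aux_marginal (fun m b => That m b (σ' m) τ) (fun m => hThat1 m _ τ) n a]
      simp only [sub_mul, Finset.sum_sub_distrib]
      rw [e, sub_self]
    | zero => simp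
    | add x y _ _ hx hy => simp [add_mul, Finset.sum_add_distrib, hx, hy]
    | smul c x _ hx => simp [mul_assoc, ← Finset.mul_sum, hx]
  have h := key _ hα
  simp only [add_mul, Finset.sum_add_distrib, ← Finset.mul_sum, hρ1, mul_one,
    Finset.sum_mul] at h
  rw [Finset.sum_comm] at h
  simpa only [mul_assoc, ← Finset.mul_sum] using h
end

section
/- (Lemma 1) Let ρ be a stationary distribution of the Markov chain T, and let 𝒯 = (𝒯_1,…,𝒯_N) be the M×(∑_n M_n) matrix collecting the strategy vectors of all players. Then the all-ones vector 1_M does not belong to span(𝒯). -/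
theorem marg_aux {N : ℕ} (M : Fin N → ℕ) (f : (m : Fin N) → Fin (M m) → ℝ)
    (hf : ∀ m, ∑ j, f m j = 1) (n : Fin N) (a : Fin (M n)) :
    ∑ σ : (∀ m, Fin (M m)), (if a = σ n then (1:ℝ) else 0) * ∏ m, f m (σ m) = f n a := by
  classical
  let g : (m : Fin N) → Fin (M m) → ℝ :=
    Function.update f n (fun j => if a = j then f n j else 0)
  have hgn : g n = fun j => if a = j then f n j else 0 := Function.update_self ..
  have hgm : ∀ m, m ≠ n → g m = f m := fun m hm => Function.update_of_ne hm ..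
  have h1 : ∀ σ : (∀ m, Fin (M m)),
      (if a = σ n then (1:ℝ) else 0) * ∏ m, f m (σ m) = ∏ m, g m (σ m) := by
    intro σ
    rw [← Finset.mul_prod_erase _ _ (Finset.mem_univ n),
      ← Finset.mul_prod_erase (a := n) Finset.univ (fun m => g m (σ m)) (Finset.mem_univ n)]
    have h2 : ∏ m ∈ Finset.univ.erase n, g m (σ m) = ∏ m ∈ Finset.univ.erase n, f m (σ m) :=
      Finset.prod_congr rfl fun m hm => by rw [hgm m (Finset.ne_of_mem_erase hm)]
    rw [h2, hgn]
    by_cases h : a = σ n <;> simp [h]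
  simp_rw [h1]
  rw [← Fintype.prod_sum, ← Finset.mul_prod_erase _ _ (Finset.mem_univ n)]
  have h3 : ∏ m ∈ Finset.univ.erase n, ∑ j, g m j = 1 :=
    Finset.prod_eq_one fun m hm => by rw [hgm m (Finset.ne_of_mem_erase hm), hf]
  rw [h3, hgn]
  simp

/-- Lemma 1: the all-ones vector does not belong to the span of the
Press–Dyson (strategy) vectors of all players, provided the induced Markov
chain has a stationary distribution `ρ`. -/
theorem ones_not_in_span_of_strategy_vectors
    (N : ℕ) (hN : 1 ≤ N) (M : Fin N → ℕ) (hM : ∀ n, 1 ≤ M n)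
    (B : Type) [Fintype B]
    (W : B → (∀ m, Fin (M m)) → ℝ)
    (hW0 : ∀ τ σ', 0 ≤ W τ σ')
    (hW1 : ∀ σ', ∑ τ, W τ σ' = 1)
    (That : (n : Fin N) → Fin (M n) → Fin (M n) → B → ℝ)
    (hThat0 : ∀ n a a' τ, 0 ≤ That n a a' τ)
    (hThat1 : ∀ n (a' : Fin (M n)) (τ : B), ∑ a, That n a a' τ = 1)
    (ρ : (∀ m, Fin (M m)) → ℝ)
    (hρ0 : ∀ σ, 0 ≤ ρ σ)
    (hρ1 : ∑ σ, ρ σ = 1)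
    (hρstat : ∀ σ, ρ σ =
      ∑ σ', (∑ τ, W τ σ' * ∏ m, That m (σ m) (σ' m) τ) * ρ σ') :
    (fun _ : ∀ m, Fin (M m) => (1 : ℝ)) ∉
      Submodule.span ℝ {v : (∀ m, Fin (M m)) → ℝ |
        ∃ (n : Fin N) (a : Fin (M n)), v = fun σ' =>
          (∑ τ, W τ σ' * That n a (σ' n) τ) - (if a = σ' n then 1 else 0)} := by
  intro hmem
  have key : ∀ v ∈ Submodule.span ℝ {v : (∀ m, Fin (M m)) → ℝ |
        ∃ (n : Fin N) (a : Fin (M n)), v = fun σ' =>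
          (∑ τ, W τ σ' * That n a (σ' n) τ) - (if a = σ' n then 1 else 0)},
      ∑ σ, v σ * ρ σ = 0 := by
    intro v hv
    induction hv using Submodule.span_induction with
    | mem v hv =>
      obtain ⟨n, a, rfl⟩ := hv
      simp only [sub_mul, Finset.sum_sub_distrib]
      rw [sub_eq_zero]
      symm
      calc ∑ σ : (∀ m, Fin (M m)), (if a = σ n then (1:ℝ) else 0) * ρ σ
          = ∑ σ : (∀ m, Fin (M m)), ∑ σ' : (∀ m, Fin (M m)), ∑ τ,
              W τ σ' * ρ σ' * ((if a = σ n then (1:ℝ) else 0) *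
                ∏ m, That m (σ m) (σ' m) τ) := by
            refine Finset.sum_congr rfl fun σ _ => ?_
            rw [hρstat σ, Finset.mul_sum]
            refine Finset.sum_congr rfl fun σ' _ => ?_
            rw [Finset.sum_mul, Finset.mul_sum]
            refine Finset.sum_congr rfl fun τ _ => ?_
            ring
        _ = ∑ σ' : (∀ m, Fin (M m)), ∑ τ, ∑ σ : (∀ m, Fin (M m)),
              W τ σ' * ρ σ' * ((if a = σ n then (1:ℝ) else 0) *
                ∏ m, That m (σ m) (σ' m) τ) := by
            rw [Finset.sum_comm]
            exact Finset.sum_congr rfl fun σ' _ => Finset.sum_comm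
        _ = _ := by
            refine Finset.sum_congr rfl fun σ' _ => ?_
            rw [Finset.sum_mul]
            refine Finset.sum_congr rfl fun τ _ => ?_
            rw [← Finset.mul_sum, marg_aux M (fun m j => That m j (σ' m) τ)
              (fun m => hThat1 m (σ' m) τ) n a]
            ring
    | zero => simp
    | add x y _ _ hx hy => simp [add_mul, Finset.sum_add_distrib, hx, hy]
    | smul c x _ hx => simp [mul_assoc, ← Finset.mul_sum, hx]
  have h := key _ hmem
  simp [hρ1] at h
end

section
/- (Proposition 1: consistency of ZD strategies) Let ρ be a stationary distribution of the Markov chain T, let N' ⊆ {1,…,N} be any subset of players, and let V = span(⋃_{n∈N'} V_n). Then the set E = { e = (1, ē) ∈ {1}×ℝ^N : eᵀα = 0 for every α ∈ ℝ^{N+1} with 𝒮α ∈ V } is nonempty; in particular, the vector (1, e_1, …, e_N) of expected payoffs belongs to E. Hence any set of ZD strategies is consistent: the linear payoff relations they enforce always admit a common solution, and incompatible linear relations are impossible. -/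
theorem zd_marginal {N : ℕ} {M : Fin N → ℕ} (p : (m : Fin N) → Fin (M m) → ℝ)
    (hp : ∀ m, ∑ b, p m b = 1) (n : Fin N) (a : Fin (M n)) :
    ∑ σ : (∀ m, Fin (M m)), (if a = σ n then (1 : ℝ) else 0) * ∏ m, p m (σ m) = p n a := by
  classical
  set g : (m : Fin N) → Fin (M m) → ℝ :=
    Function.update p n (fun b => if a = b then p n b else 0) with hg
  have h1 : ∀ σ : (∀ m, Fin (M m)),
      (if a = σ n then (1 : ℝ) else 0) * ∏ m, p m (σ m) = ∏ m, g m (σ m) := by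
    intro σ
    rw [← Finset.mul_prod_erase Finset.univ (fun m => p m (σ m)) (Finset.mem_univ n),
      ← Finset.mul_prod_erase Finset.univ (fun m => g m (σ m)) (Finset.mem_univ n), ← mul_assoc]
    congr 1
    · simp [hg]
    · refine Finset.prod_congr rfl fun m hm => ?_
      rw [hg, Function.update_of_ne (Finset.ne_of_mem_erase hm)]
  rw [Finset.sum_congr rfl fun σ _ => h1 σ]
  have h2 := Finset.prod_univ_sum (fun m => (Finset.univ : Finset (Fin (M m)))) g
  rw [Fintype.piFinset_univ] at h2
  rw [← h2, ← Finset.mul_prod_erase Finset.univ _ (Finset.mem_univ n), Finset.prod_eq_one]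
  · simp [hg]
  · intro m hm
    rw [hg, Function.update_of_ne (Finset.ne_of_mem_erase hm), hp]

/-- Proposition 1 (consistency of ZD strategies): for any subset `N'` of
players, the set `E` of payoff-vector candidates `(1, ē)` satisfying all
linear relations enforced via `V = span(⋃_{n∈N'} V_n)` is nonempty; in
particular the vector of actual expected payoffs belongs to `E`. -/
theorem zd_strategies_consistent
    (N : ℕ) (hN : 1 ≤ N) (M : Fin N → ℕ) (hM : ∀ n, 1 ≤ M n)
    (B : Type) [Fintype B]
    (W : B → (∀ m, Fin (M m)) → ℝ)
    (hW0 : ∀ τ σ', 0 ≤ W τ σ')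
    (hW1 : ∀ σ', ∑ τ, W τ σ' = 1)
    (That : (n : Fin N) → Fin (M n) → Fin (M n) → B → ℝ)
    (hThat0 : ∀ n a a' τ, 0 ≤ That n a a' τ)
    (hThat1 : ∀ n (a' : Fin (M n)) (τ : B), ∑ a, That n a a' τ = 1)
    (s : Fin N → (∀ m, Fin (M m)) → ℝ)
    (ρ : (∀ m, Fin (M m)) → ℝ)
    (hρ0 : ∀ σ, 0 ≤ ρ σ)
    (hρ1 : ∑ σ, ρ σ = 1)
    (hρstat : ∀ σ, ρ σ =
      ∑ σ', (∑ τ, W τ σ' * ∏ m, That m (σ m) (σ' m) τ) * ρ σ')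
    (N' : Set (Fin N))
    -- spans of the strategy matrices 𝒯_n
    (spanT : Fin N → Submodule ℝ ((∀ m, Fin (M m)) → ℝ))
    (hspanT : ∀ n, spanT n = Submodule.span ℝ (Set.range fun a : Fin (M n) =>
      fun σ' : ∀ m, Fin (M m) =>
        (∑ τ, W τ σ' * That n a (σ' n) τ) - (if a = σ' n then 1 else 0)))
    -- span of the columns of 𝒮 = (1_M, s_1, …, s_N)
    (spanS : Submodule ℝ ((∀ m, Fin (M m)) → ℝ))
    (hspanS : spanS = Submodule.span ℝ
      (Set.range (Fin.cons (fun _ => (1 : ℝ)) s :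
        Fin (N + 1) → (∀ m, Fin (M m)) → ℝ))) :
    -- the expected-payoff vector satisfies every enforced linear relation …
    (∀ α : Fin (N + 1) → ℝ,
      (fun σ' : ∀ m, Fin (M m) => α 0 + ∑ m, α m.succ * s m σ') ∈
        (⨆ n ∈ N', spanT n ⊓ spanS) →
      α 0 + ∑ m, α m.succ * (∑ σ, s m σ * ρ σ) = 0) ∧
    -- … hence the set E of consistent payoff vectors is nonempty
    (∃ ebar : Fin N → ℝ, ∀ α : Fin (N + 1) → ℝ,
      (fun σ' : ∀ m, Fin (M m) => α 0 + ∑ m, α m.succ * s m σ') ∈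
        (⨆ n ∈ N', spanT n ⊓ spanS) →
      α 0 + ∑ m, α m.succ * ebar m = 0) := by
  have key : ∀ α : Fin (N + 1) → ℝ,
      (fun σ' : ∀ m, Fin (M m) => α 0 + ∑ m, α m.succ * s m σ') ∈
        (⨆ n ∈ N', spanT n ⊓ spanS) →
      α 0 + ∑ m, α m.succ * (∑ σ, s m σ * ρ σ) = 0 := by
    intro α hα
    let L : ((∀ m, Fin (M m)) → ℝ) →ₗ[ℝ] ℝ := Fintype.linearCombination ℝ ρ
    have hL : ∀ v, L v = ∑ σ, v σ * ρ σ := fun v => by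
      simp [L, Fintype.linearCombination_apply]
    have hle : (⨆ n ∈ N', spanT n ⊓ spanS) ≤ LinearMap.ker L := by
      refine iSup₂_le fun n _ => inf_le_left.trans ?_
      rw [hspanT n, Submodule.span_le]
      rintro _ ⟨a, rfl⟩
      simp only [SetLike.mem_coe, LinearMap.mem_ker, hL, sub_mul, Finset.sum_sub_distrib]
      rw [sub_eq_zero]
      symm
      calc ∑ σ : (∀ m, Fin (M m)), (if a = σ n then (1 : ℝ) else 0) * ρ σ
          = ∑ σ : (∀ m, Fin (M m)), ∑ σ' : (∀ m, Fin (M m)), ∑ τ, W τ σ' * ρ σ' *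
              ((if a = σ n then (1 : ℝ) else 0) * ∏ m, That m (σ m) (σ' m) τ) := by
            refine Finset.sum_congr rfl fun σ _ => ?_
            rw [hρstat σ, Finset.mul_sum]
            refine Finset.sum_congr rfl fun σ' _ => ?_
            rw [Finset.sum_mul, Finset.mul_sum]
            refine Finset.sum_congr rfl fun τ _ => ?_
            ring
        _ = ∑ σ', (∑ τ, W τ σ' * That n a (σ' n) τ) * ρ σ' := by
            rw [Finset.sum_comm]
            refine Finset.sum_congr rfl fun σ' _ => ?_
            rw [Finset.sum_comm, Finset.sum_mul]
            refine Finset.sum_congr rfl fun τ _ => ?_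
            rw [← Finset.mul_sum, zd_marginal (fun m b => That m b (σ' m) τ)
              (fun m => hThat1 m (σ' m) τ) n a]
            ring
    have h0 := LinearMap.mem_ker.mp (hle hα)
    rw [hL] at h0
    rw [← h0]
    simp only [add_mul, Finset.sum_add_distrib, ← Finset.mul_sum, hρ1, mul_one, Finset.sum_mul]
    congr 1
    rw [Finset.sum_comm]
    refine Finset.sum_congr rfl fun m _ => ?_
    rw [Finset.mul_sum]
    exact Finset.sum_congr rfl fun σ _ => (mul_assoc _ _ _).symm
  exact ⟨key, _, key⟩
end

section
/- (Corollary of Proposition 1: at most one master value) Let ρ be a stationary distribution of the Markov chain T. Suppose there are players m and m', a player k, and constants γ, γ' ∈ ℝ such that s_k − γ·1_M ∈ span(𝒯_m) and s_k − γ'·1_M ∈ span(𝒯_{m'}) (equalizer ZD strategies controlling player k's payoff). Then γ = γ' (and e_k = γ): more than one ZD player cannot simultaneously control the expected payoff of one player to different values. -/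
theorem aux_marginal {N : ℕ} {M : Fin N → ℕ} (f : (n : Fin N) → Fin (M n) → ℝ)
    (hf : ∀ n, ∑ a, f n a = 1) (n : Fin N) (a : Fin (M n)) :
    ∑ σ : (∀ l, Fin (M l)), (if a = σ n then (1:ℝ) else 0) * ∏ l, f l (σ l) = f n a := by
  classical
  let u : (l : Fin N) → Fin (M l) → ℝ :=
    Function.update (fun _ _ => (1:ℝ)) n (fun x => if a = x then 1 else 0)
  have hun : u n = fun x => if a = x then 1 else 0 := Function.update_self ..
  have hul : ∀ l, l ≠ n → u l = fun _ => 1 := fun l hl => Function.update_of_ne hl ..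
  have h1 : ∀ σ : (∀ l, Fin (M l)),
      (if a = σ n then (1:ℝ) else 0) * ∏ l, f l (σ l) = ∏ l, (u l (σ l) * f l (σ l)) := by
    intro σ
    rw [Finset.prod_mul_distrib, Finset.prod_eq_single (f := fun l => u l (σ l)) n]
    · rw [hun]
    · intro l _ hl
      simp only [hul l hl]
    · intro h
      exact absurd (Finset.mem_univ n) h
  have h2 := Finset.prod_univ_sum (fun l => (Finset.univ : Finset (Fin (M l))))
    (fun l x => u l x * f l x)
  rw [Fintype.piFinset_univ] at h2
  rw [Finset.sum_congr rfl (fun σ _ => h1 σ), ← h2, Finset.prod_eq_single n]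
  · simp [hun]
  · intro l _ hl
    simp [hul l hl, hf]
  · intro h
    exact absurd (Finset.mem_univ n) h

theorem aux_control
    (N : ℕ) (M : Fin N → ℕ)
    (B : Type) [Fintype B]
    (W : B → (∀ m, Fin (M m)) → ℝ)
    (That : (n : Fin N) → Fin (M n) → Fin (M n) → B → ℝ)
    (hThat1 : ∀ n (a' : Fin (M n)) (τ : B), ∑ a, That n a a' τ = 1)
    (s : (∀ m, Fin (M m)) → ℝ)
    (ρ : (∀ m, Fin (M m)) → ℝ)
    (hρ1 : ∑ σ, ρ σ = 1)
    (hρstat : ∀ σ, ρ σ =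
      ∑ σ', (∑ τ, W τ σ' * ∏ m, That m (σ m) (σ' m) τ) * ρ σ')
    (m : Fin N) (γ : ℝ)
    (hm : (fun σ : ∀ l, Fin (M l) => s σ - γ) ∈
      Submodule.span ℝ (Set.range fun a : Fin (M m) =>
        fun σ' : ∀ l, Fin (M l) =>
          (∑ τ, W τ σ' * That m a (σ' m) τ) - (if a = σ' m then 1 else 0))) :
    (∑ σ, s σ * ρ σ) = γ := by
  have key : ∀ v ∈ Submodule.span ℝ (Set.range fun a : Fin (M m) =>
        fun σ' : ∀ l, Fin (M l) =>
          (∑ τ, W τ σ' * That m a (σ' m) τ) - (if a = σ' m then (1:ℝ) else 0)),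
      ∑ σ, v σ * ρ σ = 0 := by
    intro v hv
    induction hv using Submodule.span_induction with
    | mem x hx =>
      obtain ⟨a, rfl⟩ := hx
      have h : ∑ σ : (∀ l, Fin (M l)), (if a = σ m then (1:ℝ) else 0) * ρ σ
          = ∑ σ' : (∀ l, Fin (M l)), (∑ τ, W τ σ' * That m a (σ' m) τ) * ρ σ' := by
        calc _ = ∑ σ : (∀ l, Fin (M l)), ∑ σ' : (∀ l, Fin (M l)), ∑ τ,
              W τ σ' * ρ σ' * ((if a = σ m then (1:ℝ) else 0) *
                ∏ l, That l (σ l) (σ' l) τ) := by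
              refine Finset.sum_congr rfl fun σ _ => ?_
              rw [hρstat σ, Finset.mul_sum]
              refine Finset.sum_congr rfl fun σ' _ => ?_
              rw [Finset.sum_mul, Finset.mul_sum]
              refine Finset.sum_congr rfl fun τ _ => ?_
              ring
          _ = _ := by
              rw [Finset.sum_comm]
              refine Finset.sum_congr rfl fun σ' _ => ?_
              rw [Finset.sum_comm, Finset.sum_mul]
              refine Finset.sum_congr rfl fun τ _ => ?_
              rw [← Finset.mul_sum,
                aux_marginal (fun l x => That l x (σ' l) τ) (fun l => hThat1 l _ _) m a]
              ring
      simp only [sub_mul, Finset.sum_sub_distrib]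
      rw [h, sub_self]
    | zero => simp
    | add x y _ _ hx hy => simp only [Pi.add_apply, add_mul, Finset.sum_add_distrib, hx, hy, add_zero]
    | smul c x _ hx => simp only [Pi.smul_apply, smul_eq_mul, mul_assoc, ← Finset.mul_sum, hx, mul_zero]
  have := key _ hm
  simp only [sub_mul, Finset.sum_sub_distrib, ← Finset.mul_sum, hρ1] at this
  linarith

/-- Corollary of Proposition 1 (at most one master value): if two ZD players
`m` and `m'` both play equalizer strategies controlling player `k`'s expected
payoff, to values `γ` and `γ'` respectively, then `γ = γ'` and `e_k = γ`. -/
theorem at_most_one_master_value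
    (N : ℕ) (hN : 1 ≤ N) (M : Fin N → ℕ) (hM : ∀ n, 1 ≤ M n)
    (B : Type) [Fintype B]
    (W : B → (∀ m, Fin (M m)) → ℝ)
    (hW0 : ∀ τ σ', 0 ≤ W τ σ')
    (hW1 : ∀ σ', ∑ τ, W τ σ' = 1)
    (That : (n : Fin N) → Fin (M n) → Fin (M n) → B → ℝ)
    (hThat0 : ∀ n a a' τ, 0 ≤ That n a a' τ)
    (hThat1 : ∀ n (a' : Fin (M n)) (τ : B), ∑ a, That n a a' τ = 1)
    (s : Fin N → (∀ m, Fin (M m)) → ℝ)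
    (ρ : (∀ m, Fin (M m)) → ℝ)
    (hρ0 : ∀ σ, 0 ≤ ρ σ)
    (hρ1 : ∑ σ, ρ σ = 1)
    (hρstat : ∀ σ, ρ σ =
      ∑ σ', (∑ τ, W τ σ' * ∏ m, That m (σ m) (σ' m) τ) * ρ σ')
    (m m' k : Fin N) (γ γ' : ℝ)
    (hm : (fun σ : ∀ l, Fin (M l) => s k σ - γ) ∈
      Submodule.span ℝ (Set.range fun a : Fin (M m) =>
        fun σ' : ∀ l, Fin (M l) =>
          (∑ τ, W τ σ' * That m a (σ' m) τ) - (if a = σ' m then 1 else 0)))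
    (hm' : (fun σ : ∀ l, Fin (M l) => s k σ - γ') ∈
      Submodule.span ℝ (Set.range fun a : Fin (M m') =>
        fun σ' : ∀ l, Fin (M l) =>
          (∑ τ, W τ σ' * That m' a (σ' m') τ) - (if a = σ' m' then 1 else 0))) :
    γ = γ' ∧ (∑ σ, s k σ * ρ σ) = γ := by
  have h1 := aux_control N M B W That hThat1 (s k) ρ hρ1 hρstat m γ hm
  have h2 := aux_control N M B W That hThat1 (s k) ρ hρ1 hρstat m' γ' hm'
  exact ⟨h1.symm.trans h2, h1⟩
end

section
/- (Lemma 2) Let N' ⊆ {1,…,N} be a subset of players, and assume that for every n ∈ N' and every action σ_n ∈ {1,…,M_n}, the strategy vector T̃_n(σ_n) has no zero component. For each n ∈ N' let v_n be an arbitrary nonzero vector in span(𝒯_n). Then the family {v_n}_{n∈N'} is linearly independent. -/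
theorem pd_aux {m : ℕ} (hm : 1 ≤ m) {S : Type} (p : S → Fin m) (t : Fin m → S → ℝ)
    (ht : ∀ b s, b ≠ p s → 0 < t b s) (hsum : ∀ s, ∑ b, t b s = 0)
    (w : S → ℝ) (hw : w ∈ Submodule.span ℝ (Set.range t)) (hw0 : w ≠ 0) :
    ∃ a, ∀ s, p s = a → w s < 0 := by
  obtain ⟨k, hk⟩ := (Submodule.mem_span_range_iff_exists_fun ℝ).1 hw
  have : Nonempty (Fin m) := ⟨⟨0, hm⟩⟩
  obtain ⟨a, ha⟩ := Finite.exists_max k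
  have key : ∀ s, w s = ∑ b, (k b - k a) * t b s := by
    intro s
    have h1 : w s = ∑ b, k b * t b s := by
      rw [← hk]; simp [Finset.sum_apply]
    simp only [sub_mul, Finset.sum_sub_distrib, ← Finset.mul_sum, hsum, h1]
    simp
  have hex : ∃ b, k b < k a := by
    by_contra hcon
    push Not at hcon
    apply hw0
    funext s
    rw [key s]
    apply Finset.sum_eq_zero
    intro b _
    rw [le_antisymm (ha b) (hcon b)]
    simp
  obtain ⟨b, hb⟩ := hex
  refine ⟨a, fun s hs => ?_⟩
  rw [key s]
  refine Finset.sum_neg' ?_ ⟨b, Finset.mem_univ b, ?_⟩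
  · intro c _
    by_cases hc : c = a
    · simp [hc]
    · exact mul_nonpos_of_nonpos_of_nonneg (sub_nonpos.2 (ha c)) (ht c s (by rw [hs]; exact hc)).le
  · refine mul_neg_of_neg_of_pos (sub_neg.2 hb) (ht b s ?_)
    rw [hs]
    rintro rfl
    exact lt_irrefl _ hb

/-- Lemma 2: if, for every player `n` in a subset `N'`, all the Press–Dyson
vectors of player `n` have no zero component, then any choice of nonzero
vectors `v_n ∈ span 𝒯_n` (one per player in `N'`) is linearly independent. -/
theorem press_dyson_vectors_independent
    (N : ℕ) (hN : 1 ≤ N) (M : Fin N → ℕ) (hM : ∀ n, 1 ≤ M n)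
    (B : Type) [Fintype B]
    (W : B → (∀ m, Fin (M m)) → ℝ)
    (hW0 : ∀ τ σ', 0 ≤ W τ σ')
    (hW1 : ∀ σ', ∑ τ, W τ σ' = 1)
    (That : (n : Fin N) → Fin (M n) → Fin (M n) → B → ℝ)
    (hThat0 : ∀ n a a' τ, 0 ≤ That n a a' τ)
    (hThat1 : ∀ n (a' : Fin (M n)) (τ : B), ∑ a, That n a a' τ = 1)
    (N' : Set (Fin N))
    -- no zero component in any strategy vector of the players in N'
    (hnz : ∀ n ∈ N', ∀ (a : Fin (M n)) (σ' : ∀ m, Fin (M m)),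
      (∑ τ, W τ σ' * That n a (σ' n) τ) - (if a = σ' n then 1 else 0) ≠ 0)
    (v : Fin N → (∀ m, Fin (M m)) → ℝ)
    (hv : ∀ n ∈ N', v n ∈
      Submodule.span ℝ (Set.range fun a : Fin (M n) =>
        fun σ' : ∀ m, Fin (M m) =>
          (∑ τ, W τ σ' * That n a (σ' n) τ) - (if a = σ' n then 1 else 0)))
    (hv0 : ∀ n ∈ N', v n ≠ 0) :
    LinearIndependent ℝ (fun n : N' => v n) := by
  classical
  have main : ∀ n ∈ N', ∀ c : ℝ, c ≠ 0 → ∃ a, ∀ s : (∀ m, Fin (M m)), s n = a → c * v n s < 0 := by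
    intro n hn c hc
    refine pd_aux (hM n) (fun s : (∀ m, Fin (M m)) => s n) _ ?_ ?_ (c • v n)
      (Submodule.smul_mem _ c (hv n hn)) (smul_ne_zero hc (hv0 n hn))
    · intro b s hb
      have h := hnz n hn b s
      simp only [if_neg hb, sub_zero] at h ⊢
      exact lt_of_le_of_ne (Finset.sum_nonneg fun τ _ => mul_nonneg (hW0 _ _) (hThat0 _ _ _ _))
        (Ne.symm h)
    · intro s
      rw [Finset.sum_sub_distrib, Finset.sum_comm]
      simp [← Finset.mul_sum, hThat1, hW1]
  rw [Fintype.linearIndependent_iff]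
  intro g hg
  by_contra hcon
  push Not at hcon
  obtain ⟨i, hi⟩ := hcon
  have hch : ∀ n : Fin N, ∃ a : Fin (M n), ∀ (hn : n ∈ N'), g ⟨n, hn⟩ ≠ 0 →
      ∀ s : (∀ m, Fin (M m)), s n = a → g ⟨n, hn⟩ * v n s < 0 := by
    intro n
    by_cases h : ∃ hn : n ∈ N', g ⟨n, hn⟩ ≠ 0
    · obtain ⟨hn, hg0⟩ := h
      obtain ⟨a, ha⟩ := main n hn _ hg0
      exact ⟨a, fun _ _ => ha⟩
    · exact ⟨⟨0, hM n⟩, fun hn hg0 => absurd ⟨hn, hg0⟩ h⟩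
  choose s hs using hch
  have h0 : ∑ j : N', g j * v j s = 0 := by
    have := congrFun hg s
    simpa [Finset.sum_apply] using this
  have hlt : ∑ j : N', g j * v j s < 0 := by
    refine Finset.sum_neg' ?_ ⟨i, Finset.mem_univ i, ?_⟩
    · intro j _
      by_cases hj : g j = 0
      · simp [hj]
      · exact (hs j j.2 hj s rfl).le
    · exact hs i i.2 hi s rfl
  exact absurd h0 hlt.ne
end

section
/- (Proposition 2: independence of ZD strategies) Let N' ⊆ {1,…,N} be a subset of players, and assume that for every n ∈ N' and every action σ_n ∈ {1,…,M_n}, the strategy vector T̃_n(σ_n) has no zero component. Then any set {𝒯_n}_{n∈N'} of ZD strategies of the players in N' is independent: for any choice of nonzero vectors v_n ∈ V_n (n ∈ N'), the family {v_n}_{n∈N'} is linearly independent. -/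
theorem zd_aux {S : Type*} {m : ℕ} (hm : 1 ≤ m) (f : Fin m → S → ℝ) (g : S → Fin m)
    (hsum : ∀ x, ∑ a, f a x = 0) (hpos : ∀ a x, a ≠ g x → 0 < f a x)
    (w : S → ℝ) (hw : w ∈ Submodule.span ℝ (Set.range f)) (hw0 : w ≠ 0) :
    ∃ p : Fin m, ∀ x, g x = p → w x < 0 := by
  obtain ⟨c, rfl⟩ := (Submodule.mem_span_range_iff_exists_fun ℝ).1 hw
  have : Nonempty (Fin m) := ⟨⟨0, hm⟩⟩
  obtain ⟨p, hp⟩ := Finite.exists_max c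
  have key : ∀ x, (∑ a, c a • f a) x = ∑ a, (c a - c p) * f a x := by
    intro x
    simp only [sub_mul, Finset.sum_sub_distrib, ← Finset.mul_sum, hsum, mul_zero, sub_zero]
    simp [Finset.sum_apply]
  refine ⟨p, fun x hx => ?_⟩
  have hlt : ∃ a, c a < c p := by
    by_contra! h
    apply hw0
    funext y
    rw [key]
    exact Finset.sum_eq_zero fun a _ => by rw [le_antisymm (hp a) (h a)]; simp
  obtain ⟨b, hb⟩ := hlt
  rw [key]
  refine Finset.sum_neg' ?_ ⟨b, Finset.mem_univ _, ?_⟩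
  · intro a _
    by_cases ha : a = p
    · simp [ha]
    · exact mul_nonpos_of_nonpos_of_nonneg (by linarith [hp a]) (hpos a x (by rwa [hx])).le
  · refine mul_neg_of_neg_of_pos (by linarith) (hpos b x ?_)
    rintro rfl
    rw [hx] at hb
    exact lt_irrefl _ hb

/-- Proposition 2 (independence of ZD strategies): if, for every player `n` in
a subset `N'`, all the Press–Dyson vectors of player `n` have no zero
component, then any choice of nonzero vectors `v_n ∈ V_n = span 𝒯_n ∩ span 𝒮`
(one per player in `N'`) is linearly independent. -/
theorem zd_strategies_independent
    (N : ℕ) (hN : 1 ≤ N) (M : Fin N → ℕ) (hM : ∀ n, 1 ≤ M n)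
    (B : Type) [Fintype B]
    (W : B → (∀ m, Fin (M m)) → ℝ)
    (hW0 : ∀ τ σ', 0 ≤ W τ σ')
    (hW1 : ∀ σ', ∑ τ, W τ σ' = 1)
    (That : (n : Fin N) → Fin (M n) → Fin (M n) → B → ℝ)
    (hThat0 : ∀ n a a' τ, 0 ≤ That n a a' τ)
    (hThat1 : ∀ n (a' : Fin (M n)) (τ : B), ∑ a, That n a a' τ = 1)
    (s : Fin N → (∀ m, Fin (M m)) → ℝ)
    (spanS : Submodule ℝ ((∀ m, Fin (M m)) → ℝ))
    (hspanS : spanS = Submodule.span ℝ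
      (Set.range (Fin.cons (fun _ => (1 : ℝ)) s :
        Fin (N + 1) → (∀ m, Fin (M m)) → ℝ)))
    (N' : Set (Fin N))
    -- no zero component in any strategy vector of the players in N'
    (hnz : ∀ n ∈ N', ∀ (a : Fin (M n)) (σ' : ∀ m, Fin (M m)),
      (∑ τ, W τ σ' * That n a (σ' n) τ) - (if a = σ' n then 1 else 0) ≠ 0)
    (v : Fin N → (∀ m, Fin (M m)) → ℝ)
    (hv : ∀ n ∈ N', v n ∈
      Submodule.span ℝ (Set.range fun a : Fin (M n) =>
        fun σ' : ∀ m, Fin (M m) =>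
          (∑ τ, W τ σ' * That n a (σ' n) τ) - (if a = σ' n then 1 else 0))
        ⊓ spanS)
    (hv0 : ∀ n ∈ N', v n ≠ 0) :
    LinearIndependent ℝ (fun n : N' => v n) := by
  classical
  have aux : ∀ n ∈ N', ∀ w : (∀ m, Fin (M m)) → ℝ, w ∈ Submodule.span ℝ
      (Set.range fun a : Fin (M n) => fun σ' : ∀ m, Fin (M m) =>
          (∑ τ, W τ σ' * That n a (σ' n) τ) - (if a = σ' n then (1 : ℝ) else 0)) → w ≠ 0 →
      ∃ p : Fin (M n), ∀ σ' : ∀ m, Fin (M m), σ' n = p → w σ' < 0 := by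
    intro n hn w hw hw0
    refine zd_aux (hM n) _ (fun σ' => σ' n) ?_ ?_ w hw hw0
    · intro x
      rw [Finset.sum_sub_distrib, Finset.sum_comm]
      simp [← Finset.mul_sum, hThat1, hW1]
    · intro a x hax
      have h := hnz n hn a x
      simp only [if_neg hax, sub_zero] at h ⊢
      exact lt_of_le_of_ne
        (Finset.sum_nonneg fun τ _ => mul_nonneg (hW0 _ _) (hThat0 _ _ _ _)) h.symm
  have h1 : ∀ n : N', ∃ p : Fin (M n), ∀ σ' : ∀ m, Fin (M m), σ' n = p → v n σ' < 0 :=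
    fun n => aux n n.2 _ (hv n n.2).1 (hv0 n n.2)
  have h2 : ∀ n : N', ∃ p : Fin (M n), ∀ σ' : ∀ m, Fin (M m), σ' n = p → 0 < v n σ' := by
    intro n
    obtain ⟨p, hp⟩ := aux n n.2 (-v n) (Submodule.neg_mem _ (hv n n.2).1)
      (neg_ne_zero.2 (hv0 n n.2))
    exact ⟨p, fun σ' h => by simpa using hp σ' h⟩
  choose p hp using h1
  choose q hq using h2
  rw [Fintype.linearIndependent_iff]
  intro l hl i
  by_contra hi
  let x : ∀ m, Fin (M m) := fun m =>
    if h : m ∈ N' then (if 0 < l ⟨m, h⟩ then p ⟨m, h⟩ else q ⟨m, h⟩) else ⟨0, hM m⟩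
  have hx : ∀ n : N', x n = if 0 < l n then p n else q n := fun n => by simp [x, n.2]
  have hneg : ∀ n : N', l n ≠ 0 → l n * v n x < 0 := by
    intro n hn
    rcases lt_or_gt_of_ne hn with h | h
    · exact mul_neg_of_neg_of_pos h (hq n x (by rw [hx, if_neg h.not_gt]))
    · exact mul_neg_of_pos_of_neg h (hp n x (by rw [hx, if_pos h]))
  have h0 : ∑ n : N', l n * v n x = 0 := by
    simpa [Finset.sum_apply] using congrFun hl x
  have : ∑ n : N', l n * v n x < 0 := by
    refine Finset.sum_neg' ?_ ⟨i, Finset.mem_univ _, ?_⟩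
    · intro n _
      by_cases h : l n = 0
      · simp [h]
      · exact (hneg n h).le
    · exact hneg i hi
  linarith
end

section
/- (Lemma 3) Consider an N-player game that is symmetric with respect to a permutation π of {1,…,N}, and assume the N+1 columns of 𝒮 are linearly independent. Let n and n̄ be players with n ≠ π(n̄), and assume that every strategy vector T̃_n(σ_n) of player n and every strategy vector T̃_{n̄}(σ_{n̄}) of player n̄ has no zero component. Then there is no α ∈ ℝ^{N+1} with α ≠ 0 such that 𝒮α ∈ span(𝒯_n) and 𝒮α_π ∈ span(𝒯_{n̄}); that is, it is impossible for player n to enforce the linear payoff relation given by α while player n̄ enforces the relation given by α_π. -/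
lemma aux_neg {k : ℕ} {X : Type*} (T : Fin k → X → ℝ) (p : X → Fin k)
    (hT0 : ∀ a x, 0 ≤ T a x) (hT1 : ∀ x, ∑ a, T a x = 1)
    (hnz : ∀ a x, T a x - (if a = p x then 1 else 0) ≠ 0)
    (u : X → ℝ) (hu : u ∈ Submodule.span ℝ (Set.range fun a : Fin k =>
      fun x => T a x - (if a = p x then 1 else 0))) (hu0 : u ≠ 0) :
    ∃ a, ∀ x, p x = a → u x < 0 := by
  rw [Submodule.mem_span_range_iff_exists_fun] at hu
  obtain ⟨c, rfl⟩ := hu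
  have key : ∀ x, (∑ i, c i • fun x => T i x - (if i = p x then 1 else 0)) x
      = ∑ i, T i x * (c i - c (p x)) := by
    intro x
    have h1 : ∑ i, T i x * (c i - c (p x)) = ∑ i, c i * T i x - c (p x) := by
      simp only [mul_sub, Finset.sum_sub_distrib, ← Finset.sum_mul, hT1, one_mul]
      congr 1
      exact Finset.sum_congr rfl fun i _ => mul_comm _ _
    rw [h1]
    simp [Finset.sum_apply, mul_sub, Finset.sum_sub_distrib]
  obtain ⟨x0, hx0⟩ := Function.ne_iff.mp hu0
  haveI : Nonempty (Fin k) := ⟨p x0⟩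
  obtain ⟨a, ha⟩ := Finite.exists_max c
  refine ⟨a, fun x hx => ?_⟩
  rw [key, hx]
  have hex : ∃ b, c b ≠ c a := by
    by_contra! h
    apply hx0
    rw [key]
    simp [h]
  obtain ⟨b, hb⟩ := hex
  have hba : b ≠ a := fun h => hb (by rw [h])
  have hTb : 0 < T b x := by
    have h := hnz b x
    rw [hx, if_neg hba, sub_zero] at h
    exact lt_of_le_of_ne (hT0 b x) (Ne.symm h)
  refine Finset.sum_neg' (fun i _ => mul_nonpos_of_nonneg_of_nonpos (hT0 i x) (by linarith [ha i])) ⟨b, Finset.mem_univ _, ?_⟩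
  have := lt_of_le_of_ne (ha b) hb
  exact mul_neg_of_pos_of_neg hTb (by linarith)

/-- Lemma 3: in a game symmetric with respect to a permutation `π`, with the
columns of `𝒮` linearly independent, for players `n ≠ π(n̄)` whose strategy
vectors have no zero component, it is impossible that player `n` enforces the
linear relation given by `α ≠ 0` while player `n̄` enforces the one given by
`α_π`. -/
theorem no_symmetric_pair_of_relations
    (N : ℕ) (hN : 1 ≤ N) (M : Fin N → ℕ) (hM : ∀ n, 1 ≤ M n)
    (B : Type) [Fintype B]
    (W : B → (∀ m, Fin (M m)) → ℝ)
    (hW0 : ∀ τ σ', 0 ≤ W τ σ')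
    (hW1 : ∀ σ', ∑ τ, W τ σ' = 1)
    (That : (n : Fin N) → Fin (M n) → Fin (M n) → B → ℝ)
    (hThat0 : ∀ n a a' τ, 0 ≤ That n a a' τ)
    (hThat1 : ∀ n (a' : Fin (M n)) (τ : B), ∑ a, That n a a' τ = 1)
    (s : Fin N → (∀ m, Fin (M m)) → ℝ)
    -- the game is symmetric with respect to the permutation π
    (π : Equiv.Perm (Fin N))
    (hMπ : ∀ m, M (π m) = M m)
    (hsym : ∀ (l : Fin N) (σ : ∀ m, Fin (M m)),
      s (π l) σ = s l (fun m => Fin.cast (hMπ m) (σ (π m))))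
    -- the columns of 𝒮 are linearly independent
    (hSind : LinearIndependent ℝ
      (Fin.cons (fun _ => (1 : ℝ)) s : Fin (N + 1) → (∀ m, Fin (M m)) → ℝ))
    (n nbar : Fin N) (hne : n ≠ π nbar)
    -- no zero component in any strategy vector of players n and n̄
    (hnzn : ∀ (a : Fin (M n)) (σ' : ∀ m, Fin (M m)),
      (∑ τ, W τ σ' * That n a (σ' n) τ) - (if a = σ' n then 1 else 0) ≠ 0)
    (hnznbar : ∀ (a : Fin (M nbar)) (σ' : ∀ m, Fin (M m)),
      (∑ τ, W τ σ' * That nbar a (σ' nbar) τ)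
        - (if a = σ' nbar then 1 else 0) ≠ 0) :
    ¬ ∃ α : Fin (N + 1) → ℝ, α ≠ 0 ∧
      ((fun σ' : ∀ m, Fin (M m) => α 0 + ∑ m, α m.succ * s m σ') ∈
        Submodule.span ℝ (Set.range fun a : Fin (M n) =>
          fun σ' : ∀ m, Fin (M m) =>
            (∑ τ, W τ σ' * That n a (σ' n) τ) - (if a = σ' n then 1 else 0))) ∧
      ((fun σ' : ∀ m, Fin (M m) => α 0 + ∑ m, α (π m).succ * s m σ') ∈
        Submodule.span ℝ (Set.range fun a : Fin (M nbar) =>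
          fun σ' : ∀ m, Fin (M m) =>
            (∑ τ, W τ σ' * That nbar a (σ' nbar) τ)
              - (if a = σ' nbar then 1 else 0))) := by
  rintro ⟨α, hα, hu, hv⟩
  have hT0 : ∀ (l : Fin N) (a : Fin (M l)) (x : ∀ m, Fin (M m)),
      0 ≤ ∑ τ, W τ x * That l a (x l) τ := fun l a x =>
    Finset.sum_nonneg fun τ _ => mul_nonneg (hW0 _ _) (hThat0 _ _ _ _)
  have hT1 : ∀ (l : Fin N) (x : ∀ m, Fin (M m)),
      ∑ a, ∑ τ, W τ x * That l a (x l) τ = 1 := by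
    intro l x
    rw [Finset.sum_comm]
    simp only [← Finset.mul_sum, hThat1, mul_one, hW1]
  have hrel : ∀ σ : ∀ m, Fin (M m), α 0 + ∑ m, α m.succ * s m σ
      = α 0 + ∑ m, α (π m).succ * s m (fun m => Fin.cast (hMπ m) (σ (π m))) := by
    intro σ
    congr 1
    rw [← Equiv.sum_comp π]
    exact Finset.sum_congr rfl fun m _ => by rw [hsym]
  have hu0 : (fun σ' : ∀ m, Fin (M m) => α 0 + ∑ m, α m.succ * s m σ') ≠ 0 := by
    intro h
    apply hα
    rw [Fintype.linearIndependent_iff] at hSind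
    funext i
    refine hSind α ?_ i
    rw [← h]
    funext x
    simp [Fin.sum_univ_succ]
  have hv0 : (fun σ' : ∀ m, Fin (M m) => α 0 + ∑ m, α (π m).succ * s m σ') ≠ 0 := by
    intro h
    apply hu0
    funext σ
    exact (hrel σ).trans (congrFun h _)
  obtain ⟨a, ha⟩ := aux_neg (fun a x => ∑ τ, W τ x * That n a (x n) τ) (fun x => x n)
    (hT0 n) (hT1 n) hnzn _ hu hu0
  obtain ⟨b, hb⟩ := aux_neg (fun a x => ∑ τ, W τ x * That nbar a (x nbar) τ) (fun x => x nbar)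
    (hT0 nbar) (hT1 nbar) hnznbar _ (Submodule.neg_mem _ hv) (neg_ne_zero.mpr hv0)
  let σ : ∀ m, Fin (M m) := Function.update
    (Function.update (fun m => ⟨0, hM m⟩) n a) (π nbar) (Fin.cast (hMπ nbar).symm b)
  have h1 := ha σ (by simp [σ, hne])
  have h2 := hb (fun m => Fin.cast (hMπ m) (σ (π m))) (by simp [σ])
  have h3 := hrel σ
  simp only [Pi.neg_apply] at h1 h2
  linarith
end

section
/- (Corollary of Lemma 3) Consider an N-player game that is symmetric with respect to a permutation π of {1,…,N}, assume the N+1 columns of 𝒮 are linearly independent, and let n be a player with π(n) ≠ n all of whose strategy vectors T̃_n(σ_n) have no zero component. Then there is no nonzero α ∈ ℝ^{N+1} with α_π = α and 𝒮α ∈ span(𝒯_n): no such player can enforce a linear payoff relation having the same symmetry as the game itself. -/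
/-- Corollary of Lemma 3: in a game symmetric with respect to a permutation
`π`, with the columns of `𝒮` linearly independent, a player `n` with
`π(n) ≠ n` whose strategy vectors have no zero component cannot enforce a
linear payoff relation `α ≠ 0` having the same symmetry as the game
(`α_π = α`). -/
theorem no_relation_with_game_symmetry
    (N : ℕ) (hN : 1 ≤ N) (M : Fin N → ℕ) (hM : ∀ n, 1 ≤ M n)
    (B : Type) [Fintype B]
    (W : B → (∀ m, Fin (M m)) → ℝ)
    (hW0 : ∀ τ σ', 0 ≤ W τ σ')
    (hW1 : ∀ σ', ∑ τ, W τ σ' = 1)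
    (That : (n : Fin N) → Fin (M n) → Fin (M n) → B → ℝ)
    (hThat0 : ∀ n a a' τ, 0 ≤ That n a a' τ)
    (hThat1 : ∀ n (a' : Fin (M n)) (τ : B), ∑ a, That n a a' τ = 1)
    (s : Fin N → (∀ m, Fin (M m)) → ℝ)
    -- the game is symmetric with respect to the permutation π
    (π : Equiv.Perm (Fin N))
    (hMπ : ∀ m, M (π m) = M m)
    (hsym : ∀ (l : Fin N) (σ : ∀ m, Fin (M m)),
      s (π l) σ = s l (fun m => Fin.cast (hMπ m) (σ (π m))))
    -- the columns of 𝒮 are linearly independent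
    (hSind : LinearIndependent ℝ
      (Fin.cons (fun _ => (1 : ℝ)) s : Fin (N + 1) → (∀ m, Fin (M m)) → ℝ))
    (n : Fin N) (hne : π n ≠ n)
    -- no zero component in any strategy vector of player n
    (hnzn : ∀ (a : Fin (M n)) (σ' : ∀ m, Fin (M m)),
      (∑ τ, W τ σ' * That n a (σ' n) τ) - (if a = σ' n then 1 else 0) ≠ 0) :
    ¬ ∃ α : Fin (N + 1) → ℝ, α ≠ 0 ∧
      (∀ m, α (π m).succ = α m.succ) ∧
      ((fun σ' : ∀ m, Fin (M m) => α 0 + ∑ m, α m.succ * s m σ') ∈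
        Submodule.span ℝ (Set.range fun a : Fin (M n) =>
          fun σ' : ∀ m, Fin (M m) =>
            (∑ τ, W τ σ' * That n a (σ' n) τ)
              - (if a = σ' n then 1 else 0))) := by
  rintro ⟨α, hα, hαπ, hmem⟩
  rw [Submodule.mem_span_range_iff_exists_fun] at hmem
  obtain ⟨c, hc⟩ := hmem
  have hT0 : ∀ a (σ' : ∀ m, Fin (M m)), 0 ≤ ∑ τ, W τ σ' * That n a (σ' n) τ := fun a σ' =>
    Finset.sum_nonneg fun τ _ => mul_nonneg (hW0 _ _) (hThat0 _ _ _ _)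
  have hT1 : ∀ (σ' : ∀ m, Fin (M m)), ∑ a, ∑ τ, W τ σ' * That n a (σ' n) τ = 1 := by
    intro σ'
    rw [Finset.sum_comm]
    simp_rw [← Finset.mul_sum, hThat1, mul_one]
    exact hW1 σ'
  have hv : ∀ σ' : ∀ m, Fin (M m), α 0 + ∑ m, α m.succ * s m σ'
      = ∑ a, (c a - c (σ' n)) * ∑ τ, W τ σ' * That n a (σ' n) τ := by
    intro σ'
    have h := congrFun hc σ'
    simp only [Finset.sum_apply, Pi.smul_apply, smul_eq_mul] at h
    rw [← h]
    simp_rw [mul_sub, sub_mul, Finset.sum_sub_distrib]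
    rw [← Finset.mul_sum, hT1]
    simp
  have hsymv : ∀ σ : ∀ m, Fin (M m),
      α 0 + ∑ m, α m.succ * s m (fun m => Fin.cast (hMπ m) (σ (π m)))
        = α 0 + ∑ m, α m.succ * s m σ := by
    intro σ
    congr 1
    rw [← Equiv.sum_comp π (fun m => α m.succ * s m σ)]
    exact Finset.sum_congr rfl fun m _ => by rw [hαπ, hsym]
  haveI : Nonempty (Fin (M n)) := ⟨⟨0, hM n⟩⟩
  obtain ⟨x, hx⟩ := Finite.exists_max c
  obtain ⟨y, hy⟩ := Finite.exists_min c
  let σ₀ : ∀ m, Fin (M m) := fun m => ⟨0, hM m⟩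
  let σ : ∀ m, Fin (M m) :=
    Function.update (Function.update σ₀ n x) (π n) (Fin.cast (hMπ n).symm y)
  have hσn : σ n = x := by
    simp [σ, Function.update_of_ne hne.symm]
  have hσπ : σ (π n) = Fin.cast (hMπ n).symm y := by
    simp [σ]
  have h1 : ∀ a ∈ Finset.univ, (c a - c (σ n)) * ∑ τ, W τ σ * That n a (σ n) τ ≤ 0 := by
    intro a _
    refine mul_nonpos_of_nonpos_of_nonneg ?_ (hT0 _ _)
    rw [hσn]; linarith [hx a]
  have h2 : 0 ≤ α 0 + ∑ m, α m.succ * s m σ := by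
    rw [← hsymv, hv]
    refine Finset.sum_nonneg fun a _ => mul_nonneg ?_ (hT0 _ _)
    have : Fin.cast (hMπ n) (σ (π n)) = y := by rw [hσπ]; simp
    simp only [this]
    linarith [hy a]
  rw [hv] at h2
  have h3 := (Finset.sum_eq_zero_iff_of_nonpos h1).1 (le_antisymm (Finset.sum_nonpos h1) h2)
  have hconst : ∀ a, c a = c x := by
    intro a
    by_cases hax : a = x
    · rw [hax]
    · have h4 := h3 a (Finset.mem_univ a)
      have h5 := hnzn a σ
      rw [if_neg (by rw [hσn]; exact hax), sub_zero] at h5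
      rcases mul_eq_zero.1 h4 with h | h
      · rw [hσn] at h; linarith
      · exact absurd h h5
  apply hα
  have hli := Fintype.linearIndependent_iff.1 hSind α (by
    funext σ'
    have h := hv σ'
    simp only [hconst, sub_self, zero_mul, Finset.sum_const_zero] at h
    rw [Fin.sum_univ_succ]
    simpa [Finset.sum_apply] using h)
  funext i
  exact hli i
end

section
/- (Proposition 3) Let N ≥ 2, consider a weakly symmetric N-player game whose matrix 𝒮 has linearly independent columns, let ρ be a stationary distribution of the Markov chain T, and let k be a player all of whose strategy vectors T̃_k(σ_k) have no zero component. Then dim V_k ≤ N − 1: a ZD strategy of player k with dimension N (simultaneously enforcing N independent linear payoff relations) is impossible. -/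
lemma zd_aux_pos {X : Type*} {m : ℕ} (p : X → Fin m) (f : Fin m → X → ℝ)
    (hsum : ∀ x, ∑ a, f a x = 0) (hpos : ∀ a x, a ≠ p x → 0 < f a x)
    (u : X → ℝ) (hu : u ∈ Submodule.span ℝ (Set.range f)) (hne : u ≠ 0) :
    ∃ b, ∀ x, p x = b → 0 < u x := by
  obtain ⟨c, rfl⟩ := (Submodule.mem_span_range_iff_exists_fun ℝ).1 hu
  have hX : ∃ x : X, True := by
    by_contra h
    push Not at h
    exact hne (funext fun x => (h x).elim)
  obtain ⟨x0, -⟩ := hX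
  haveI : Nonempty (Fin m) := ⟨p x0⟩
  obtain ⟨b, hb⟩ := Finite.exists_min c
  have key : ∀ x, (∑ a, c a • f a) x = ∑ a, (c a - c b) * f a x := by
    intro x
    simp only [Finset.sum_apply, Pi.smul_apply, smul_eq_mul, sub_mul, Finset.sum_sub_distrib,
      ← Finset.mul_sum, hsum, mul_zero, sub_zero]
  refine ⟨b, fun x hx => ?_⟩
  rw [key]
  apply Finset.sum_pos'
  · intro a _
    by_cases h : a = b
    · simp [h]
    · exact mul_nonneg (sub_nonneg.2 (hb a)) (hpos a x (hx ▸ h)).le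
  · by_contra hcon
    push Not at hcon
    apply hne
    funext y
    rw [key]
    apply Finset.sum_eq_zero
    intro a _
    have h1 := hcon a (Finset.mem_univ a)
    by_cases h : a = b
    · simp [h]
    · have h2 := hpos a x (hx ▸ h)
      have h3 : c a - c b = 0 := by
        rcases (sub_nonneg.2 (hb a)).lt_or_eq with h4 | h4
        · exact absurd (mul_pos h4 h2) (not_lt.2 h1)
        · exact h4.symm
      simp [h3]

lemma zd_aux_marg {N : ℕ} {M : Fin N → ℕ} (k : Fin N) (a : Fin (M k))
    (g : ∀ m, Fin (M m) → ℝ) (hg : ∀ m, ∑ x, g m x = 1) :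
    ∑ σ : (∀ m, Fin (M m)), (if a = σ k then (1 : ℝ) else 0) * ∏ m, g m (σ m) = g k a := by
  classical
  have h := Finset.prod_univ_sum (fun m => (Finset.univ : Finset (Fin (M m))))
    (Function.update g k (fun x => if a = x then g k x else 0))
  rw [Fintype.piFinset_univ] at h
  have e : ∀ σ : (∀ m, Fin (M m)), (if a = σ k then (1 : ℝ) else 0) * ∏ m, g m (σ m)
      = ∏ m, (Function.update g k (fun x => if a = x then g k x else 0)) m (σ m) := by
    intro σ
    rw [← Finset.mul_prod_erase Finset.univ (fun m => g m (σ m)) (Finset.mem_univ k),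
      ← Finset.mul_prod_erase Finset.univ
        (fun m => (Function.update g k (fun x => if a = x then g k x else 0)) m (σ m))
        (Finset.mem_univ k), Function.update_self, ← mul_assoc]
    congr 1
    · split_ifs <;> simp
    · apply Finset.prod_congr rfl
      intro m hm
      rw [Function.update_of_ne (Finset.ne_of_mem_erase hm)]
  rw [Finset.sum_congr rfl (fun σ _ => e σ), ← h,
    ← Finset.mul_prod_erase Finset.univ _ (Finset.mem_univ k), Function.update_self,
    Finset.prod_eq_one]
  · simp
  · intro m hm
    rw [Function.update_of_ne (Finset.ne_of_mem_erase hm)]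
    exact hg m

/-- Proposition 3: in a weakly symmetric `N`-player game (`N ≥ 2`) whose
matrix `𝒮` has linearly independent columns, a player `k` whose strategy
vectors have no zero component cannot have an `N`-dimensional ZD strategy:
`dim V_k ≤ N − 1`. -/
theorem no_N_dimensional_zd_nonzero_pd
    (N : ℕ) (hN : 2 ≤ N) (M : Fin N → ℕ) (hM : ∀ n, 1 ≤ M n)
    (B : Type) [Fintype B]
    (W : B → (∀ m, Fin (M m)) → ℝ)
    (hW0 : ∀ τ σ', 0 ≤ W τ σ')
    (hW1 : ∀ σ', ∑ τ, W τ σ' = 1)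
    (That : (n : Fin N) → Fin (M n) → Fin (M n) → B → ℝ)
    (hThat0 : ∀ n a a' τ, 0 ≤ That n a a' τ)
    (hThat1 : ∀ n (a' : Fin (M n)) (τ : B), ∑ a, That n a a' τ = 1)
    (s : Fin N → (∀ m, Fin (M m)) → ℝ)
    -- the game is weakly symmetric
    (hws : ∀ n nbar : Fin N, ∃ (π : Equiv.Perm (Fin N))
      (hMπ : ∀ m, M (π m) = M m), π n = nbar ∧
      ∀ (l : Fin N) (σ : ∀ m, Fin (M m)),
        s (π l) σ = s l (fun m => Fin.cast (hMπ m) (σ (π m))))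
    -- the columns of 𝒮 are linearly independent
    (hSind : LinearIndependent ℝ
      (Fin.cons (fun _ => (1 : ℝ)) s : Fin (N + 1) → (∀ m, Fin (M m)) → ℝ))
    -- stationary distribution of the induced Markov chain
    (ρ : (∀ m, Fin (M m)) → ℝ)
    (hρ0 : ∀ σ, 0 ≤ ρ σ)
    (hρ1 : ∑ σ, ρ σ = 1)
    (hρstat : ∀ σ, ρ σ =
      ∑ σ', (∑ τ, W τ σ' * ∏ m, That m (σ m) (σ' m) τ) * ρ σ')
    (k : Fin N)
    -- no zero component in any strategy vector of player k
    (hnzk : ∀ (a : Fin (M k)) (σ' : ∀ m, Fin (M m)),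
      (∑ τ, W τ σ' * That k a (σ' k) τ) - (if a = σ' k then 1 else 0) ≠ 0) :
    Module.finrank ℝ
      ↥(Submodule.span ℝ (Set.range fun a : Fin (M k) =>
          fun σ' : ∀ m, Fin (M m) =>
            (∑ τ, W τ σ' * That k a (σ' k) τ) - (if a = σ' k then 1 else 0))
        ⊓ Submodule.span ℝ
          (Set.range (Fin.cons (fun _ => (1 : ℝ)) s :
            Fin (N + 1) → (∀ m, Fin (M m)) → ℝ)))
      ≤ N - 1 := by
  classical
  set f : Fin (M k) → (∀ m, Fin (M m)) → ℝ := fun a σ' =>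
    (∑ τ, W τ σ' * That k a (σ' k) τ) - (if a = σ' k then 1 else 0) with hf
  set S := Submodule.span ℝ (Set.range (Fin.cons (fun _ => (1 : ℝ)) s :
            Fin (N + 1) → (∀ m, Fin (M m)) → ℝ)) with hS
  have hfsum : ∀ x, ∑ a, f a x = 0 := by
    intro x
    simp only [hf, Finset.sum_sub_distrib]
    rw [Finset.sum_comm]
    simp only [← Finset.mul_sum, hThat1, mul_one, hW1]
    simp
  have hfpos : ∀ a x, a ≠ x k → 0 < f a x := by
    intro a x hax
    refine lt_of_le_of_ne ?_ (Ne.symm (hnzk a x))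
    simp only [hf, if_neg hax, sub_zero]
    exact Finset.sum_nonneg fun τ _ => mul_nonneg (hW0 _ _) (hThat0 _ _ _ _)
  let φ : ((∀ m, Fin (M m)) → ℝ) →ₗ[ℝ] ℝ := Fintype.linearCombination ℝ ρ
  have hφ : ∀ v, φ v = ∑ σ, v σ * ρ σ := fun v => by
    simp [φ, Fintype.linearCombination_apply]
  have hφf : ∀ a, φ (f a) = 0 := by
    intro a
    rw [hφ]
    simp only [hf, sub_mul, Finset.sum_sub_distrib]
    rw [sub_eq_zero]
    symm
    calc ∑ σ, (if a = σ k then (1 : ℝ) else 0) * ρ σ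
        = ∑ σ : (∀ m, Fin (M m)), ∑ σ' : (∀ m, Fin (M m)), ∑ τ, (W τ σ' * ρ σ') *
            ((if a = σ k then (1 : ℝ) else 0) * ∏ m, That m (σ m) (σ' m) τ) := by
          refine Finset.sum_congr rfl fun σ _ => ?_
          conv_lhs => rw [hρstat σ]
          rw [Finset.mul_sum]
          refine Finset.sum_congr rfl fun σ' _ => ?_
          rw [Finset.sum_mul, Finset.mul_sum]
          exact Finset.sum_congr rfl fun τ _ => by ring
      _ = ∑ σ', (∑ τ, W τ σ' * That k a (σ' k) τ) * ρ σ' := by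
          rw [Finset.sum_comm]
          refine Finset.sum_congr rfl fun σ' _ => ?_
          rw [Finset.sum_comm, Finset.sum_mul]
          refine Finset.sum_congr rfl fun τ _ => ?_
          rw [← Finset.mul_sum,
            zd_aux_marg k a (fun m x => That m x (σ' m) τ) (fun m => hThat1 m _ τ)]
          ring
  have hone : (fun _ => (1 : ℝ) : (∀ m, Fin (M m)) → ℝ) ∈ S :=
    Submodule.subset_span ⟨0, by simp⟩
  have hsS : ∀ n, s n ∈ S := fun n => Submodule.subset_span ⟨n.succ, by simp⟩
  have hφone : φ (fun _ => 1) = 1 := by rw [hφ]; simpa using hρ1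
  have hle : Submodule.span ℝ (Set.range f) ⊓ S ≤ S ⊓ LinearMap.ker φ := by
    refine le_inf inf_le_right (inf_le_left.trans (Submodule.span_le.2 ?_))
    rintro _ ⟨a, rfl⟩
    exact hφf a
  have hfrS : Module.finrank ℝ S = N + 1 := by
    rw [hS, finrank_span_eq_card hSind, Fintype.card_fin]
  have hlt : S ⊓ LinearMap.ker φ < S := by
    refine lt_of_le_of_ne inf_le_left fun h => ?_
    have h1 : (fun _ => (1 : ℝ) : (∀ m, Fin (M m)) → ℝ) ∈ S ⊓ LinearMap.ker φ := by
      rw [h]; exact hone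
    have h2 : φ (fun _ => 1) = 0 := h1.2
    rw [hφone] at h2
    exact one_ne_zero h2
  have hfr := Submodule.finrank_lt_finrank_of_lt hlt
  by_contra hcon
  have heq : Submodule.span ℝ (Set.range f) ⊓ S = S ⊓ LinearMap.ker φ :=
    Submodule.eq_of_le_of_finrank_le hle (by omega)
  let u : Fin N → (∀ m, Fin (M m)) → ℝ := fun n => s n - φ (s n) • (fun _ => (1 : ℝ))
  have hu : ∀ n, u n ∈ Submodule.span ℝ (Set.range f) := by
    intro n
    have : u n ∈ S ⊓ LinearMap.ker φ := by
      refine ⟨S.sub_mem (hsS n) (S.smul_mem _ hone), ?_⟩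
      rw [SetLike.mem_coe, LinearMap.mem_ker, map_sub, map_smul, hφone]
      simp
    rw [← heq] at this
    exact this.1
  have hune : ∀ n, u n ≠ 0 := by
    intro n h
    have h2 := Fintype.linearIndependent_iff.1 hSind
      (Fin.cons (-φ (s n)) (Pi.single n 1)) (by
        rw [Fin.sum_univ_succ]
        simp only [Fin.cons_zero, Fin.cons_succ]
        rw [Finset.sum_eq_single n]
        · rw [← h]; simp only [u, Pi.single_eq_same]; module
        · intro b _ hb; simp [hb]
        · simp) n.succ
    simp at h2
  have hp : ∀ n, ∃ b, ∀ x : (∀ m, Fin (M m)), x k = b → φ (s n) < s n x := by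
    intro n
    obtain ⟨b, hb⟩ := zd_aux_pos (fun x => x k) f hfsum hfpos (u n) (hu n) (hune n)
    refine ⟨b, fun x hx => ?_⟩
    have := hb x hx
    simp [u] at this
    linarith
  have hn : ∀ n, ∃ b, ∀ x : (∀ m, Fin (M m)), x k = b → s n x < φ (s n) := by
    intro n
    obtain ⟨b, hb⟩ := zd_aux_pos (fun x => x k) f hfsum hfpos (-u n)
      (Submodule.neg_mem _ (hu n)) (neg_ne_zero.2 (hune n))
    refine ⟨b, fun x hx => ?_⟩
    have := hb x hx
    simp [u] at this
    linarith
  haveI : Nontrivial (Fin N) := Fin.nontrivial_iff_two_le.2 hN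
  obtain ⟨n, hnk⟩ := exists_ne k
  obtain ⟨π, hMπ, hπ, hsym⟩ := hws k n
  subst hπ
  have x0 : ∀ m, Fin (M m) := fun m => ⟨0, hM m⟩
  have mk : ∀ (c : Fin (M k)) (d : Fin (M k)), ∃ x : (∀ m, Fin (M m)),
      x k = c ∧ Fin.cast (hMπ k) (x (π k)) = d := by
    intro c d
    refine ⟨Function.update (Function.update x0 (π k) (Fin.cast (hMπ k).symm d)) k c, ?_, ?_⟩
    · simp
    · rw [Function.update_of_ne hnk, Function.update_self]; simp
  obtain ⟨b1, hb1⟩ := hp k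
  obtain ⟨a1, ha1⟩ := hn k
  obtain ⟨b2, hb2⟩ := hp (π k)
  obtain ⟨a2, ha2⟩ := hn (π k)
  obtain ⟨x, hx1, hx2⟩ := mk a2 b1
  obtain ⟨y, hy1, hy2⟩ := mk b2 a1
  have e1 := ha2 x hx1
  have e2 := hb2 y hy1
  rw [hsym] at e1 e2
  have e3 := hb1 (fun m => Fin.cast (hMπ m) (x (π m))) hx2
  have e4 := ha1 (fun m => Fin.cast (hMπ m) (y (π m))) hy2
  linarith
end

section
/- (Proposition 4) Let N ≥ 2 and M ≥ 2. Consider a weakly symmetric N-player game in which, for every player n, the payoffs s_n(σ), σ ∈ Σ, are pairwise distinct. Then there is no player k and no constant C ∈ ℝ such that s_n − C·1_M ∈ span(𝒯_k) for every n ∈ {1,…,N}; consequently, no player can employ an N-dimensional ZD strategy simultaneously pinning all players' expected payoffs to a common value C. -/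
theorem zd_aux_s11 {S : Type*} {m : ℕ} (hm : 1 ≤ m) (T : Fin m → S → ℝ) (p : S → Fin m)
    (h0 : ∀ a x, 0 ≤ T a x) (h1 : ∀ x, ∑ a, T a x = 1) (u : S → ℝ)
    (hu : u ∈ Submodule.span ℝ (Set.range fun a : Fin m =>
      fun x : S => T a x - (if a = p x then 1 else 0))) :
    ∃ a b : Fin m, (∀ x, p x = a → u x ≤ 0) ∧ (∀ x, p x = b → 0 ≤ u x) ∧
      (a = b → ∀ x, u x = 0) := by
  have : Nonempty (Fin m) := ⟨⟨0, hm⟩⟩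
  obtain ⟨c, hc⟩ := (Submodule.mem_span_range_iff_exists_fun ℝ).1 hu
  have hux : ∀ x, u x = ∑ a, (c a - c (p x)) * T a x := by
    intro x
    have h2 := congrFun hc x
    rw [← h2]
    simp only [Finset.sum_apply, Pi.smul_apply, smul_eq_mul, mul_sub, sub_mul,
      Finset.sum_sub_distrib, ← Finset.mul_sum, h1]
    simp
  obtain ⟨a, ha⟩ := Finite.exists_max c
  obtain ⟨b, hb⟩ := Finite.exists_min c
  refine ⟨a, b, ?_, ?_, ?_⟩
  · intro x hx
    rw [hux, hx]
    exact Finset.sum_nonpos fun i _ =>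
      mul_nonpos_of_nonpos_of_nonneg (sub_nonpos.2 (ha i)) (h0 i x)
  · intro x hx
    rw [hux, hx]
    exact Finset.sum_nonneg fun i _ => mul_nonneg (sub_nonneg.2 (hb i)) (h0 i x)
  · rintro rfl x
    have hcc : ∀ i, c i = c a := fun i => le_antisymm (ha i) (hb i)
    rw [hux]
    exact Finset.sum_eq_zero fun i _ => by rw [hcc i, hcc (p x)]; ring


/-- Proposition 4: in a weakly symmetric `N`-player game (`N ≥ 2`, `M ≥ 2`)
in which each player's payoffs are pairwise distinct over the states, no
player `k` can have an `N`-dimensional ZD strategy pinning all players'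
expected payoffs to a common value `C`, i.e. with `s_n − C·1_M ∈ span 𝒯_k`
for all `n`. -/
theorem no_N_dimensional_zd_distinct_payoffs
    (N : ℕ) (hN : 2 ≤ N) (M : Fin N → ℕ) (hM : ∀ n, 1 ≤ M n)
    -- the number of states M = ∏ₙ Mₙ is at least 2
    (hMcard : 2 ≤ Fintype.card (∀ m, Fin (M m)))
    (B : Type) [Fintype B]
    (W : B → (∀ m, Fin (M m)) → ℝ)
    (hW0 : ∀ τ σ', 0 ≤ W τ σ')
    (hW1 : ∀ σ', ∑ τ, W τ σ' = 1)
    (That : (n : Fin N) → Fin (M n) → Fin (M n) → B → ℝ)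
    (hThat0 : ∀ n a a' τ, 0 ≤ That n a a' τ)
    (hThat1 : ∀ n (a' : Fin (M n)) (τ : B), ∑ a, That n a a' τ = 1)
    (s : Fin N → (∀ m, Fin (M m)) → ℝ)
    -- the game is weakly symmetric
    (hws : ∀ n nbar : Fin N, ∃ (π : Equiv.Perm (Fin N))
      (hMπ : ∀ m, M (π m) = M m), π n = nbar ∧
      ∀ (l : Fin N) (σ : ∀ m, Fin (M m)),
        s (π l) σ = s l (fun m => Fin.cast (hMπ m) (σ (π m))))
    -- payoffs of each player are pairwise distinct over the states
    (hdist : ∀ n : Fin N, Function.Injective (s n)) :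
    ¬ ∃ (k : Fin N) (C : ℝ), ∀ n : Fin N,
      (fun σ : ∀ m, Fin (M m) => s n σ - C) ∈
        Submodule.span ℝ (Set.range fun a : Fin (M k) =>
          fun σ' : ∀ m, Fin (M m) =>
            (∑ τ, W τ σ' * That k a (σ' k) τ)
              - (if a = σ' k then 1 else 0)) := by
  rintro ⟨k, C, h⟩
  have key := fun n => zd_aux_s11 (hM k) (fun a σ' => ∑ τ, W τ σ' * That k a (σ' k) τ)
    (fun σ' => σ' k)
    (fun a x => Finset.sum_nonneg fun τ _ => mul_nonneg (hW0 τ x) (hThat0 k a (x k) τ))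
    (fun x => by
      rw [Finset.sum_comm]
      simp only [← Finset.mul_sum, hThat1, mul_one, hW1]) _ (h n)
  obtain ⟨j, hj⟩ : ∃ j : Fin N, j ≠ k := by
    have : Nontrivial (Fin N) := Fin.nontrivial_iff_two_le.2 hN
    exact exists_ne k
  obtain ⟨π, hMπ, hπ, hs⟩ := hws k j
  subst hπ
  obtain ⟨a, b, ha, hb, hab⟩ := key (π k)
  obtain ⟨a', b', ha', hb', -⟩ := key k
  let z : ∀ m, Fin (M m) := fun m => ⟨0, hM m⟩
  -- the two states
  let x : ∀ m, Fin (M m) :=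
    Function.update (Function.update z k a) (π k) (Fin.cast (hMπ k).symm b')
  let y : ∀ m, Fin (M m) :=
    Function.update (Function.update z k b) (π k) (Fin.cast (hMπ k).symm a')
  have hxk : x k = a := by simp [x, Function.update_of_ne hj.symm]
  have hyk : y k = b := by simp [y, Function.update_of_ne hj.symm]
  have hxj : x (π k) = Fin.cast (hMπ k).symm b' := by simp [x]
  have hyj : y (π k) = Fin.cast (hMπ k).symm a' := by simp [y]
  have e1 := ha x hxk
  have e2 := hb y hyk
  have e3 := hb' (fun m => Fin.cast (hMπ m) (x (π m))) (by simp [hxj])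
  have e4 := ha' (fun m => Fin.cast (hMπ m) (y (π m))) (by simp [hyj])
  simp only [← hs] at e3 e4
  have hxy : x = y := hdist (π k) (by linarith)
  have h0 := hab (by rw [← hxk, ← hyk, hxy])
  have : Nontrivial (∀ m, Fin (M m)) := Fintype.one_lt_card_iff_nontrivial.1 hMcard
  obtain ⟨p, q, hpq⟩ := exists_pair_ne (∀ m, Fin (M m))
  exact hpq (hdist (π k) (by
    have := h0 p
    have := h0 q
    linarith))
end

section
/- (No ZD strategy in rock–paper–scissors) Consider the two-player three-action perfect-monitoring game with M_1 = M_2 = 3, states (σ_1,σ_2) ordered lexicographically, and payoff vectors s_1 = (0,1,−1,−1,0,1,1,−1,0)ᵀ and s_2 = −s_1 (the rock–paper–scissors game). Then for every memory-one strategy of player 1, V_1 = span(𝒯_1) ∩ span(𝒮) = {0}: no ZD strategy of player 1 exists in the rock–paper–scissors game. -/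
/-- Payoff vector of player 1 in the rock–paper–scissors game, with states
`(σ₁, σ₂)` ordered lexicographically:
`s₁ = (0,1,−1,−1,0,1,1,−1,0)ᵀ`. -/
noncomputable def rpsPayoff1 : Fin 3 × Fin 3 → ℝ :=
  fun σ => !![(0 : ℝ), 1, -1; -1, 0, 1; 1, -1, 0] σ.1 σ.2

/-- No ZD strategy exists in the rock–paper–scissors game: for every
memory-one strategy of player 1, `V₁ = span 𝒯₁ ∩ span 𝒮 = {0}`. -/
theorem rps_no_zd_strategy
    (T1 : Fin 3 → Fin 3 × Fin 3 → ℝ)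
    (hT0 : ∀ a σ', 0 ≤ T1 a σ')
    (hT1 : ∀ σ' : Fin 3 × Fin 3, ∑ a, T1 a σ' = 1) :
    Submodule.span ℝ (Set.range fun a : Fin 3 =>
        fun σ' : Fin 3 × Fin 3 => T1 a σ' - (if a = σ'.1 then 1 else 0))
      ⊓ Submodule.span ℝ
        {(fun _ => (1 : ℝ)), rpsPayoff1, -rpsPayoff1}
      = ⊥ := by
  rw [eq_bot_iff]
  rintro v ⟨h1, h2⟩
  rw [SetLike.mem_coe, Submodule.mem_span_range_iff_exists_fun] at h1
  rw [SetLike.mem_coe, Submodule.mem_span_triple] at h2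
  obtain ⟨c, hc⟩ := h1
  obtain ⟨x, y, z, hv⟩ := h2
  have key : ∀ σ' : Fin 3 × Fin 3, v σ' = ∑ a, (c a - c σ'.1) * T1 a σ' := by
    intro σ'
    have e : ∑ a, (c a - c σ'.1) * T1 a σ' = ∑ a, c a * T1 a σ' - c σ'.1 := by
      simp only [sub_mul, Finset.sum_sub_distrib, ← Finset.mul_sum, hT1, mul_one]
    rw [e, ← hc]
    simp [Finset.sum_apply, mul_sub, Finset.sum_sub_distrib]
  have hvs : ∀ σ', v σ' = x + (y - z) * rpsPayoff1 σ' := by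
    intro σ'
    rw [← hv]
    simp
    ring
  obtain ⟨m, hm⟩ := Finite.exists_max c
  obtain ⟨n, hn⟩ := Finite.exists_min c
  have hle : ∀ j, x + (y - z) * rpsPayoff1 (m, j) ≤ 0 := by
    intro j
    rw [← hvs, key]
    exact Finset.sum_nonpos fun a _ =>
      mul_nonpos_of_nonpos_of_nonneg (sub_nonpos.2 (hm a)) (hT0 _ _)
  have hge : ∀ j, 0 ≤ x + (y - z) * rpsPayoff1 (n, j) := by
    intro j
    rw [← hvs, key]
    exact Finset.sum_nonneg fun a _ => mul_nonneg (sub_nonneg.2 (hn a)) (hT0 _ _)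
  have row : ∀ i : Fin 3, ∃ j0 j1 j2, rpsPayoff1 (i, j0) = 0 ∧ rpsPayoff1 (i, j1) = 1 ∧
      rpsPayoff1 (i, j2) = -1 := by
    intro i
    fin_cases i
    · exact ⟨0, 1, 2, by simp [rpsPayoff1], by simp [rpsPayoff1], by simp [rpsPayoff1]⟩
    · exact ⟨1, 2, 0, by simp [rpsPayoff1], by simp [rpsPayoff1], by simp [rpsPayoff1]⟩
    · exact ⟨2, 0, 1, by simp [rpsPayoff1], by simp [rpsPayoff1], by simp [rpsPayoff1]⟩
  obtain ⟨a0, a1, a2, ha0, ha1, ha2⟩ := row m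
  obtain ⟨b0, b1, b2, hb0, hb1, hb2⟩ := row n
  have p0 := hle a0
  have p1 := hle a1
  have p2 := hle a2
  have q0 := hge b0
  rw [ha0] at p0
  rw [ha1] at p1
  rw [ha2] at p2
  rw [hb0] at q0
  have hx : x = 0 := by linarith
  have hy : y - z = 0 := by linarith
  rw [Submodule.mem_bot]
  funext σ'
  rw [hvs, hx, hy]
  simp
end

section
/- (One player simultaneously enforcing two linear relations) Consider the two-player three-action perfect-monitoring game with states ordered lexicographically and payoff vectors s_1 = (0,r_1,0,r_2,0,0,0,0,0)ᵀ, s_2 = (0,r_2,0,r_1,0,0,0,0,0)ᵀ. Let player 1's strategy be given by the columns T_1(1) = (1,1−p,1,p',0,0,0,0,0)ᵀ, T_1(2) = (0,q,0,1−q',1,1,0,0,0)ᵀ, T_1(3) = (0,p−q,0,q'−p',0,0,1,1,1)ᵀ with 0 ≤ p,q,p',q' ≤ 1, q ≤ p, p' ≤ q', and p'q − pq' ≠ 0. Then [(q'r_1+q r_2)·T̃_1(1) + (p'r_1+p r_2)·T̃_1(2)]/(p'q − pq') = s_1 and [(q'r_2+q r_1)·T̃_1(1) + (p'r_2+p r_1)·T̃_1(2)]/(p'q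 − pq') = s_2. In particular s_1, s_2 ∈ span(𝒯_1), and for any strategy of player 2 and any stationary distribution ρ of the induced Markov chain, the expected payoffs satisfy e_1 = e_2 = 0: player 1 simultaneously controls both players' expected payoffs. -/
/-- Payoff vector `s₁ = (0,r₁,0,r₂,0,0,0,0,0)ᵀ` (states ordered
lexicographically). -/
noncomputable def payoff1 (r1 r2 : ℝ) : Fin 3 × Fin 3 → ℝ :=
  fun σ => !![(0 : ℝ), r1, 0; r2, 0, 0; 0, 0, 0] σ.1 σ.2

/-- Player 1's strategy: columns `T₁(1) = (1,1−p,1,p',0,0,0,0,0)ᵀ`,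
`T₁(2) = (0,q,0,1−q',1,1,0,0,0)ᵀ`, `T₁(3) = (0,p−q,0,q'−p',0,0,1,1,1)ᵀ`. -/
noncomputable def stratCol (p q p' q' : ℝ) : Fin 3 → Fin 3 × Fin 3 → ℝ :=
  fun a σ' =>
    ![!![(1 : ℝ), 1 - p, 1; p', 0, 0; 0, 0, 0],
      !![(0 : ℝ), q, 0; 1 - q', 1, 1; 0, 0, 0],
      !![(0 : ℝ), p - q, 0; q' - p', 0, 0; 1, 1, 1]] a σ'.1 σ'.2

/-- Press–Dyson vectors of player 1 for the above strategy. -/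
noncomputable def stratPD (p q p' q' : ℝ) : Fin 3 → Fin 3 × Fin 3 → ℝ :=
  fun a σ' => stratCol p q p' q' a σ' - (if a = σ'.1 then 1 else 0)

theorem comb_eq (r1 r2 p q p' q' : ℝ) (hden : p' * q - p * q' ≠ 0) :
    (fun σ' : Fin 3 × Fin 3 =>
        ((q' * r1 + q * r2) * stratPD p q p' q' 0 σ'
          + (p' * r1 + p * r2) * stratPD p q p' q' 1 σ') / (p' * q - p * q'))
      = payoff1 r1 r2 := by
  funext ⟨i, j⟩
  rw [div_eq_iff hden]
  fin_cases i <;> fin_cases j <;> simp [stratPD, stratCol, payoff1] <;> ring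

theorem comb_span (r1 r2 p q p' q' : ℝ) (hden : p' * q - p * q' ≠ 0) :
    payoff1 r1 r2 ∈ Submodule.span ℝ (Set.range (stratPD p q p' q')) := by
  have h : payoff1 r1 r2 =
      ((q' * r1 + q * r2) / (p' * q - p * q')) • stratPD p q p' q' 0
      + ((p' * r1 + p * r2) / (p' * q - p * q')) • stratPD p q p' q' 1 := by
    rw [← comb_eq r1 r2 p q p' q' hden]
    funext σ
    simp only [Pi.add_apply, Pi.smul_apply, smul_eq_mul]
    ring
  rw [h]
  exact Submodule.add_mem _
    (Submodule.smul_mem _ _ (Submodule.subset_span ⟨0, rfl⟩))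
    (Submodule.smul_mem _ _ (Submodule.subset_span ⟨1, rfl⟩))

theorem akin (p q p' q' : ℝ) (T2 : Fin 3 → Fin 3 × Fin 3 → ℝ)
    (h2 : ∀ σ' : Fin 3 × Fin 3, ∑ a, T2 a σ' = 1)
    (ρ : Fin 3 × Fin 3 → ℝ)
    (hst : ∀ σ : Fin 3 × Fin 3, ρ σ =
          ∑ σ', (stratCol p q p' q' σ.1 σ' * T2 σ.2 σ') * ρ σ') (a : Fin 3) :
    ∑ σ, stratPD p q p' q' a σ * ρ σ = 0 := by
  have h1 : ∑ b, ρ (a, b) = ∑ σ', stratCol p q p' q' a σ' * ρ σ' := by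
    rw [Finset.sum_congr rfl (fun b _ => hst (a, b)), Finset.sum_comm]
    refine Finset.sum_congr rfl fun σ' _ => ?_
    dsimp only
    rw [← Finset.sum_mul, ← Finset.mul_sum, h2, mul_one]
  have h3 : ∑ σ : Fin 3 × Fin 3, (if a = σ.1 then (1 : ℝ) else 0) * ρ σ = ∑ b, ρ (a, b) := by
    rw [Fintype.sum_prod_type, Finset.sum_eq_single a]
    · simp
    · intro i _ hi
      simp [Ne.symm hi]
    · simp
  simp only [stratPD, sub_mul, Finset.sum_sub_distrib]
  rw [h3, h1, sub_self]

theorem payoff_zero (r1 r2 p q p' q' : ℝ) (hden : p' * q - p * q' ≠ 0)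
    (ρ : Fin 3 × Fin 3 → ℝ)
    (h : ∀ a, ∑ σ, stratPD p q p' q' a σ * ρ σ = 0) :
    ∑ σ, payoff1 r1 r2 σ * ρ σ = 0 := by
  have h' : ∑ σ, payoff1 r1 r2 σ * ρ σ =
      ((q' * r1 + q * r2) / (p' * q - p * q')) * ∑ σ, stratPD p q p' q' 0 σ * ρ σ
      + ((p' * r1 + p * r2) / (p' * q - p * q')) * ∑ σ, stratPD p q p' q' 1 σ * ρ σ := by
    rw [← comb_eq r1 r2 p q p' q' hden, Finset.mul_sum, Finset.mul_sum, ← Finset.sum_add_distrib]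
    refine Finset.sum_congr rfl fun σ _ => ?_
    ring
  rw [h', h, h, mul_zero, mul_zero, add_zero]

/-- One player simultaneously enforcing two linear relations: with the above
strategy, suitable linear combinations of the Press–Dyson vectors of player 1
equal `s₁` and `s₂`; hence `s₁, s₂ ∈ span 𝒯₁`, and for any strategy of
player 2 and any stationary distribution of the induced Markov chain the
expected payoffs satisfy `e₁ = e₂ = 0`. -/
theorem one_player_two_relations
    (r1 r2 p q p' q' : ℝ)
    (hp : 0 ≤ p ∧ p ≤ 1) (hq : 0 ≤ q ∧ q ≤ 1)
    (hp' : 0 ≤ p' ∧ p' ≤ 1) (hq' : 0 ≤ q' ∧ q' ≤ 1)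
    (hqp : q ≤ p) (hpq' : p' ≤ q')
    (hden : p' * q - p * q' ≠ 0) :
    (fun σ' : Fin 3 × Fin 3 =>
        ((q' * r1 + q * r2) * stratPD p q p' q' 0 σ'
          + (p' * r1 + p * r2) * stratPD p q p' q' 1 σ') / (p' * q - p * q'))
      = payoff1 r1 r2 ∧
    (fun σ' : Fin 3 × Fin 3 =>
        ((q' * r2 + q * r1) * stratPD p q p' q' 0 σ'
          + (p' * r2 + p * r1) * stratPD p q p' q' 1 σ') / (p' * q - p * q'))
      = payoff1 r2 r1 ∧
    payoff1 r1 r2 ∈ Submodule.span ℝ (Set.range (stratPD p q p' q')) ∧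
    payoff1 r2 r1 ∈ Submodule.span ℝ (Set.range (stratPD p q p' q')) ∧
    ∀ T2 : Fin 3 → Fin 3 × Fin 3 → ℝ,
      (∀ a σ', 0 ≤ T2 a σ') →
      (∀ σ' : Fin 3 × Fin 3, ∑ a, T2 a σ' = 1) →
      ∀ ρ : Fin 3 × Fin 3 → ℝ,
        (∀ σ, 0 ≤ ρ σ) →
        (∑ σ, ρ σ = 1) →
        (∀ σ : Fin 3 × Fin 3, ρ σ =
          ∑ σ', (stratCol p q p' q' σ.1 σ' * T2 σ.2 σ') * ρ σ') →
        (∑ σ, payoff1 r1 r2 σ * ρ σ) = 0 ∧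
        (∑ σ, payoff1 r2 r1 σ * ρ σ) = 0 := by
  refine ⟨comb_eq r1 r2 p q p' q' hden, comb_eq r2 r1 p q p' q' hden,
    comb_span r1 r2 p q p' q' hden, comb_span r2 r1 p q p' q' hden, ?_⟩
  intro T2 _ h2 ρ _ _ hst
  have h := akin p q p' q' T2 h2 ρ hst
  exact ⟨payoff_zero r1 r2 p q p' q' hden ρ h, payoff_zero r2 r1 p q p' q' hden ρ h⟩
end

section
/- (ZD strategy exists in some symmetric zero-sum game) Consider the two-player three-action perfect-monitoring symmetric zero-sum game with states ordered lexicographically, payoff vectors s_1 = (0,r,0,−r,0,0,0,0,0)ᵀ and s_2 = −s_1 with r ≠ 0. Let player 1's strategy be given by the columns T_1(1) = (1,1−p,1,p',0,0,0,0,0)ᵀ, T_1(2) = (0,q,0,1−q',1,1,0,0,0)ᵀ, T_1(3) = (0,p−q,0,q'−p',0,0,1,1,1)ᵀ with 0 ≤ p,q,p',q' ≤ 1, q ≤ p, p' ≤ q', and p'q − pq' ≠ 0. Then r·[(q'−q)·T̃_1(1) + (p'−p)·T̃_1(2)]/(p'q − pq') = s_1; hence s_1 ∈ span(𝒯_1)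 ∩ span(𝒮) and player 1 possesses a ZD strategy, which enforces e_1 = e_2 = 0 for any strategy of player 2 and any stationary distribution of the induced Markov chain. -/
/-- Payoff vector `s₁ = (0,r,0,−r,0,0,0,0,0)ᵀ` of the symmetric zero-sum game
(states ordered lexicographically); `s₂ = −s₁`. -/
noncomputable def zsPayoff1 (r : ℝ) : Fin 3 × Fin 3 → ℝ :=
  fun σ => !![(0 : ℝ), r, 0; -r, 0, 0; 0, 0, 0] σ.1 σ.2

/-- Player 1's strategy: columns `T₁(1) = (1,1−p,1,p',0,0,0,0,0)ᵀ`,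
`T₁(2) = (0,q,0,1−q',1,1,0,0,0)ᵀ`, `T₁(3) = (0,p−q,0,q'−p',0,0,1,1,1)ᵀ`. -/
noncomputable def zsStratCol (p q p' q' : ℝ) : Fin 3 → Fin 3 × Fin 3 → ℝ :=
  fun a σ' =>
    ![!![(1 : ℝ), 1 - p, 1; p', 0, 0; 0, 0, 0],
      !![(0 : ℝ), q, 0; 1 - q', 1, 1; 0, 0, 0],
      !![(0 : ℝ), p - q, 0; q' - p', 0, 0; 1, 1, 1]] a σ'.1 σ'.2

/-- Press–Dyson vectors of player 1 for the above strategy. -/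
noncomputable def zsStratPD (p q p' q' : ℝ) : Fin 3 → Fin 3 × Fin 3 → ℝ :=
  fun a σ' => zsStratCol p q p' q' a σ' - (if a = σ'.1 then 1 else 0)

/-- A ZD strategy exists in some two-player three-action symmetric zero-sum
game: `r·[(q'−q)·T̃₁(1) + (p'−p)·T̃₁(2)]/(p'q−pq') = s₁`, hence
`s₁ ∈ span 𝒯₁ ∩ span 𝒮` (a ZD strategy of player 1), and it enforces
`e₁ = e₂ = 0` for any strategy of player 2 and any stationary distribution. -/
theorem zd_exists_in_symmetric_zero_sum_game
    (r p q p' q' : ℝ) (hr : r ≠ 0)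
    (hp : 0 ≤ p ∧ p ≤ 1) (hq : 0 ≤ q ∧ q ≤ 1)
    (hp' : 0 ≤ p' ∧ p' ≤ 1) (hq' : 0 ≤ q' ∧ q' ≤ 1)
    (hqp : q ≤ p) (hpq' : p' ≤ q')
    (hden : p' * q - p * q' ≠ 0) :
    (fun σ' : Fin 3 × Fin 3 =>
        r * ((q' - q) * zsStratPD p q p' q' 0 σ'
          + (p' - p) * zsStratPD p q p' q' 1 σ') / (p' * q - p * q'))
      = zsPayoff1 r ∧
    zsPayoff1 r ∈ Submodule.span ℝ (Set.range (zsStratPD p q p' q'))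
      ⊓ Submodule.span ℝ
        {(fun _ => (1 : ℝ)), zsPayoff1 r, -zsPayoff1 r} ∧
    ∀ T2 : Fin 3 → Fin 3 × Fin 3 → ℝ,
      (∀ a σ', 0 ≤ T2 a σ') →
      (∀ σ' : Fin 3 × Fin 3, ∑ a, T2 a σ' = 1) →
      ∀ ρ : Fin 3 × Fin 3 → ℝ,
        (∀ σ, 0 ≤ ρ σ) →
        (∑ σ, ρ σ = 1) →
        (∀ σ : Fin 3 × Fin 3, ρ σ =
          ∑ σ', (zsStratCol p q p' q' σ.1 σ' * T2 σ.2 σ') * ρ σ') →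
        (∑ σ, zsPayoff1 r σ * ρ σ) = 0 ∧
        (∑ σ, -zsPayoff1 r σ * ρ σ) = 0 := by
  have key : (fun σ' : Fin 3 × Fin 3 =>
        r * ((q' - q) * zsStratPD p q p' q' 0 σ'
          + (p' - p) * zsStratPD p q p' q' 1 σ') / (p' * q - p * q'))
      = zsPayoff1 r := by
    funext σ
    rw [div_eq_iff hden]
    obtain ⟨a, b⟩ := σ
    fin_cases a <;> fin_cases b <;>
      simp [zsStratPD, zsStratCol, zsPayoff1, -mul_eq_mul_left_iff] <;> ring
  refine ⟨key, ⟨?_, ?_⟩, ?_⟩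
  · have h : zsPayoff1 r = (r * (q' - q) / (p' * q - p * q')) • zsStratPD p q p' q' 0
        + (r * (p' - p) / (p' * q - p * q')) • zsStratPD p q p' q' 1 := by
      rw [← key]
      funext σ
      simp only [Pi.add_apply, Pi.smul_apply, smul_eq_mul]
      ring
    rw [h]
    exact Submodule.add_mem _
      (Submodule.smul_mem _ _ (Submodule.subset_span ⟨0, rfl⟩))
      (Submodule.smul_mem _ _ (Submodule.subset_span ⟨1, rfl⟩))
  · exact Submodule.subset_span (by simp)
  · intro T2 _ hT2 ρ _ _ hst
    have akin : ∀ a, ∑ σ', zsStratPD p q p' q' a σ' * ρ σ' = 0 := by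
      intro a
      have h1 : ∑ b, ρ (a, b) = ∑ σ', zsStratCol p q p' q' a σ' * ρ σ' := by
        rw [Finset.sum_congr rfl (fun b _ => hst (a, b)), Finset.sum_comm]
        refine Finset.sum_congr rfl fun σ' _ => ?_
        dsimp only
        rw [← Finset.sum_mul, ← Finset.mul_sum, hT2, mul_one]
      have h2 : ∑ σ' : Fin 3 × Fin 3, (if a = σ'.1 then (1 : ℝ) else 0) * ρ σ'
          = ∑ b, ρ (a, b) := by
        rw [Fintype.sum_prod_type, Finset.sum_eq_single a]
        · simp
        · intro c _ hc
          simp [Ne.symm hc]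
        · simp
      simp only [zsStratPD, sub_mul, Finset.sum_sub_distrib]
      rw [h2, h1, sub_self]
    have h0 : (∑ σ, zsPayoff1 r σ * ρ σ) = 0 := by
      have h : (∑ σ, zsPayoff1 r σ * ρ σ)
          = (r * (q' - q) / (p' * q - p * q')) * ∑ σ', zsStratPD p q p' q' 0 σ' * ρ σ'
          + (r * (p' - p) / (p' * q - p * q')) * ∑ σ', zsStratPD p q p' q' 1 σ' * ρ σ' := by
        rw [← key, Finset.mul_sum, Finset.mul_sum, ← Finset.sum_add_distrib]
        refine Finset.sum_congr rfl fun σ _ => ?_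
        ring
      rw [h, akin, akin]
      simp
    refine ⟨h0, ?_⟩
    simp only [neg_mul, Finset.sum_neg_distrib, h0, neg_zero]
end

section
/- (Simultaneous control in a symmetric two-player game forces equal payoffs) Consider a two-player perfect-monitoring game with M_1 = M_2 = m that is symmetric under swapping the players, i.e., s_2(σ_1,σ_2) = s_1(σ_2,σ_1) for all states (σ_1,σ_2). Suppose player 1's strategy satisfies s_1 − C_1·1_M ∈ span(𝒯_1) and s_2 − C_2·1_M ∈ span(𝒯_1) for constants C_1, C_2 ∈ ℝ. Then C_1 = C_2: if one player simultaneously enforces e_1 = C_1 and e_2 = C_2 by a single ZD strategy in a symmetric two-player game, then necessarily C_1 = C_2. -/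
/-- Simultaneous control in a symmetric two-player game forces equal payoffs:
if the game is symmetric (`s₂(σ₁,σ₂) = s₁(σ₂,σ₁)`) and player 1's single
(memory-one) ZD strategy satisfies `s₁ − C₁·1 ∈ span 𝒯₁` and
`s₂ − C₂·1 ∈ span 𝒯₁`, then `C₁ = C₂`. -/
theorem symmetric_simultaneous_control_equal
    (m : ℕ) (hm : 1 ≤ m)
    (s1 s2 : Fin m × Fin m → ℝ)
    (hsym : ∀ σ : Fin m × Fin m, s2 σ = s1 (σ.2, σ.1))
    (T1 : Fin m → Fin m × Fin m → ℝ)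
    (hT0 : ∀ a σ', 0 ≤ T1 a σ')
    (hT1 : ∀ σ' : Fin m × Fin m, ∑ a, T1 a σ' = 1)
    (C1 C2 : ℝ)
    (h1 : (fun σ : Fin m × Fin m => s1 σ - C1) ∈
      Submodule.span ℝ (Set.range fun a : Fin m =>
        fun σ' : Fin m × Fin m => T1 a σ' - (if a = σ'.1 then 1 else 0)))
    (h2 : (fun σ : Fin m × Fin m => s2 σ - C2) ∈
      Submodule.span ℝ (Set.range fun a : Fin m =>
        fun σ' : Fin m × Fin m => T1 a σ' - (if a = σ'.1 then 1 else 0))) :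
    C1 = C2 := by
  have h := Submodule.sub_mem _ h1 h2
  obtain ⟨c, hc⟩ := (Submodule.mem_span_range_iff_exists_fun ℝ).1 h
  have key : ∀ b : Fin m, ∑ a, c a * T1 a (b, b) - c b = C2 - C1 := by
    intro b
    have e := congrFun hc (b, b)
    have hs := hsym (b, b)
    simp only [Finset.sum_apply, Pi.smul_apply, Pi.sub_apply, smul_eq_mul, mul_sub,
      Finset.sum_sub_distrib, mul_ite, mul_one, mul_zero, Finset.sum_ite_eq',
      Finset.mem_univ, if_true] at e hs
    linarith
  haveI : Nonempty (Fin m) := ⟨⟨0, hm⟩⟩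
  obtain ⟨p, hp⟩ := Finite.exists_max c
  obtain ⟨q, hq⟩ := Finite.exists_min c
  have hP : ∑ a, c a * T1 a (p, p) ≤ c p := by
    calc ∑ a, c a * T1 a (p, p) ≤ ∑ a, c p * T1 a (p, p) :=
          Finset.sum_le_sum fun a _ => mul_le_mul_of_nonneg_right (hp a) (hT0 _ _)
      _ = c p := by rw [← Finset.mul_sum, hT1, mul_one]
  have hQ : c q ≤ ∑ a, c a * T1 a (q, q) := by
    calc c q = ∑ a, c q * T1 a (q, q) := by rw [← Finset.mul_sum, hT1, mul_one]
      _ ≤ ∑ a, c a * T1 a (q, q) :=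
          Finset.sum_le_sum fun a _ => mul_le_mul_of_nonneg_right (hq a) (hT0 _ _)
  have k1 := key p
  have k2 := key q
  linarith
end

section
/- (Equalizer ZD strategy in a two-action game with public monitoring) Consider the two-player two-action public-monitoring game with signal set B = {1,2}, signal probabilities W(1|1,1) = 1/2, W(1|1,2) = w, W(1|2,1) = 1−w, W(1|2,2) = 1/2 with w ≠ 1/2, states ordered (1,1),(1,2),(2,1),(2,2), and payoff vectors s_1 = (R,S,T,P)ᵀ, s_2 = (R,T,S,P)ᵀ. Let β, γ ∈ ℝ and define player 1's strategy by T̂_1(1|1,1) = [2(1−w)R−T]β/(1−2w) + γ + 1, T̂_1(1|1,2) = (T−2wR)β/(1−2w) + γ + 1, T̂_1(1|2,1) = (S−2wP)β/(1−2w) + γ, T̂_1(1|2,2) = [2(1−w)P−S]β/(1−2w) + γ, with T̂_1(2|σ'_1,τ) = 1 − T̂_1(1|σ'_1,τ), assuming all these values lie in [0,1]. Then the strategy vector satisfies T̃_1(1) = β·s_2 + γ·1_4; consequently, if β ≠ 0, for any strategy of player 2 and any stationary distribution of the induced Markov chain, the expected payoff of player 2 equals e_2 = −γ/β (equalizer strategy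 under imperfect monitoring). -/
/-- Equalizer ZD strategy in a two-player two-action game with public
monitoring.  Signals `τ ∈ {1,2}` are encoded as `Fin 2` (index `0` is signal
`1`), actions `{1,2}` as `Fin 2` (index `0` is action `1`), and states are
ordered `(1,1),(1,2),(2,1),(2,2)`.  With the indicated strategy of player 1,
its Press–Dyson vector equals `β·s₂ + γ·1₄`; consequently, if `β ≠ 0`, for
any strategy of player 2 and any stationary distribution of the induced
Markov chain, `e₂ = −γ/β`. -/
theorem equalizer_public_monitoring
    (w R S T P β γ : ℝ) (hw : w ≠ 1 / 2)
    (s1 s2 : Fin 2 × Fin 2 → ℝ)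
    (hs1 : s1 = fun σ => !![R, S; T, P] σ.1 σ.2)
    (hs2 : s2 = fun σ => !![R, T; S, P] σ.1 σ.2)
    -- signal probabilities
    (W : Fin 2 → Fin 2 × Fin 2 → ℝ)
    (hW0 : ∀ τ σ', 0 ≤ W τ σ')
    (hWsum : ∀ σ' : Fin 2 × Fin 2, W 1 σ' = 1 - W 0 σ')
    (hW11 : W 0 (0, 0) = 1 / 2)
    (hW12 : W 0 (0, 1) = w)
    (hW21 : W 0 (1, 0) = 1 - w)
    (hW22 : W 0 (1, 1) = 1 / 2)
    -- player 1's strategy T̂₁(action | previous own action, signal)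
    (That1 : Fin 2 → Fin 2 → Fin 2 → ℝ)
    (hT11 : That1 0 0 0 = (2 * (1 - w) * R - T) * β / (1 - 2 * w) + γ + 1)
    (hT12 : That1 0 0 1 = (T - 2 * w * R) * β / (1 - 2 * w) + γ + 1)
    (hT21 : That1 0 1 0 = (S - 2 * w * P) * β / (1 - 2 * w) + γ)
    (hT22 : That1 0 1 1 = (2 * (1 - w) * P - S) * β / (1 - 2 * w) + γ)
    (hTnorm : ∀ (a' τ : Fin 2), That1 1 a' τ = 1 - That1 0 a' τ)
    (hTrange : ∀ (a a' τ : Fin 2), 0 ≤ That1 a a' τ ∧ That1 a a' τ ≤ 1) :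
    -- the Press–Dyson vector T̃₁(1) equals β·s₂ + γ·1₄ …
    (fun σ' : Fin 2 × Fin 2 =>
        (∑ τ, W τ σ' * That1 0 σ'.1 τ) - (if (0 : Fin 2) = σ'.1 then 1 else 0))
      = (fun σ' => β * s2 σ' + γ) ∧
    -- … hence, if β ≠ 0, player 1 unilaterally sets e₂ = −γ/β
    (β ≠ 0 →
      ∀ That2 : Fin 2 → Fin 2 → Fin 2 → ℝ,
        (∀ a a' τ, 0 ≤ That2 a a' τ) →
        (∀ (a' τ : Fin 2), ∑ a, That2 a a' τ = 1) →
        ∀ ρ : Fin 2 × Fin 2 → ℝ,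
          (∀ σ, 0 ≤ ρ σ) →
          (∑ σ, ρ σ = 1) →
          (∀ σ : Fin 2 × Fin 2, ρ σ =
            ∑ σ', (∑ τ, W τ σ' * That1 σ.1 σ'.1 τ * That2 σ.2 σ'.2 τ) * ρ σ') →
          (∑ σ, s2 σ * ρ σ) = -γ / β) := by
  have hd : 1 - 2 * w ≠ 0 := fun h => hw (by linarith)
  have hu : (1 - 2 * w) * (1 - 2 * w)⁻¹ = 1 := mul_inv_cancel₀ hd
  have key : ∀ σ' : Fin 2 × Fin 2,
      (∑ τ, W τ σ' * That1 0 σ'.1 τ) - (if (0 : Fin 2) = σ'.1 then 1 else 0)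
        = β * s2 σ' + γ := by
    rintro ⟨i, j⟩
    subst hs2
    fin_cases i <;> fin_cases j <;>
      simp [Fin.sum_univ_two, hWsum, hW11, hW12, hW21, hW22, hT11, hT12, hT21, hT22]
    · linear_combination (R * β) * hu
    · linear_combination (T * β) * hu
    · linear_combination (S * β) * hu
    · linear_combination (P * β) * hu
  refine ⟨funext key, ?_⟩
  intro hβ That2 _ h2 ρ _ hρ hst
  have k00 := key (0, 0)
  have k01 := key (0, 1)
  have k10 := key (1, 0)
  have k11 := key (1, 1)
  have a := hst (0, 0)
  have b := hst (0, 1)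
  have e : ∀ a' τ : Fin 2, That2 1 a' τ = 1 - That2 0 a' τ := by
    intro a' τ
    have := h2 a' τ
    rw [Fin.sum_univ_two] at this
    linarith
  simp only [Fintype.sum_prod_type, Fin.sum_univ_two, e] at a b hρ k00 k01 k10 k11 ⊢
  simp only [if_true, zero_ne_one, if_false] at k00 k01 k10 k11
  rw [eq_div_iff hβ]
  linear_combination (-ρ (0, 0)) * k00 - ρ (0, 1) * k01 - ρ (1, 0) * k10 - ρ (1, 1) * k11
    - a - b - γ * hρ
end
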